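/- Let T : ℝ^d × 𝒳 → 𝒳 be a continuous action of ℝ^d on a compact metric space (𝒳, 𝐝). Let λ be a Borel probability measure on M^T(𝒳) and let μ = ∫_{M^T(𝒳)} ν dλ(ν) be its barycenter. Let ε > 0 and let M^T(𝒳) ∋ ν ↦ ε_ν ∈ (0,∞) be a measurable function with ∫_{M^T(𝒳)} ε_ν dλ(ν) ≤ ε. Suppose there is a constant c > 0 with ε_ν ≥ c for all ν ∈ M^T(𝒳). Then R(𝐝, μ, ε) ≤ ∫_{M^T(𝒳)} R(𝐝, ν, ε_ν) dλ(ν). -/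

import Mathlib

open MeasureTheory Filter Set
open scoped ENNReal Topology NNReal

noncomputable section

/-- Shannon entropy (base 2) of a finitely-valued random variable. -/
def shannonEntropy {Ω S : Type*} [MeasurableSpace Ω] [Fintype S]
    (P : Measure Ω) (f : Ω → S) : ℝ :=
  -∑ i : S, ((P (f ⁻¹' {i})).toReal * Real.logb 2 ((P (f ⁻¹' {i})).toReal))

/-- Mutual information (base 2) of two random variables, defined as the supremum over all
finite measurable partitions (encoded as measurable maps into `Fin n`) of
`H(α∘X) + H(β∘Y) - H(α∘X, β∘Y)`. -/
def mutualInfo {Ω A B : Type*} [MeasurableSpace Ω] [MeasurableSpace A] [MeasurableSpace B]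
    (P : Measure Ω) (X : Ω → A) (Y : Ω → B) : ℝ≥0∞ :=
  ⨆ (n : ℕ) (m : ℕ) (α : A → Fin n) (_ : Measurable α) (β : B → Fin m) (_ : Measurable β),
    ENNReal.ofReal (shannonEntropy P (fun ω => α (X ω)) + shannonEntropy P (fun ω => β (Y ω))
      - shannonEntropy P (fun ω => (α (X ω), β (Y ω))))

/-- The box `[0,L)^d ⊆ ℝ^d`. -/
def unitBox (d : ℕ) (L : ℝ) : Set (Fin d → ℝ) := Set.univ.pi fun _ => Set.Ico (0 : ℝ) L

/-- Lebesgue measure on `ℝ^d` restricted to the box `[0,L)^d`. -/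
def boxMeasure (d : ℕ) (L : ℝ) : Measure (Fin d → ℝ) := volume.restrict (unitBox d L)

/-- The space `L¹([0,L)^d, X)` of measurable maps modulo a.e. equality. -/
abbrev L1Maps (d : ℕ) (L : ℝ) (X : Type*) [TopologicalSpace X] :=
  (Fin d → ℝ) →ₘ[boxMeasure d L] X

/-- The `L¹` distance `D(f,g) = ∫_{[0,L)^d} 𝐝(f(u), g(u)) dm(u)`. -/
def L1dist {d : ℕ} {L : ℝ} {X : Type*} [MetricSpace X] (f g : L1Maps d L X) : ℝ :=
  ∫ u, dist (f u) (g u) ∂(boxMeasure d L)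

/-- The Borel σ-algebra of the metric `L1dist` on `L¹([0,L)^d, X)`,
generated by the open balls of the metric. -/
instance L1Maps.measurableSpace {d : ℕ} {L : ℝ} {X : Type*} [MetricSpace X] :
    MeasurableSpace (L1Maps d L X) :=
  MeasurableSpace.generateFrom {s | ∃ (f : L1Maps d L X) (r : ℝ), s = {g | L1dist f g < r}}

/-- The expected mean distortion `E[(1/L^d) ∫_{[0,L)^d} 𝐝(T^u X, Y_u) dm(u)]`. -/
def distortion {X : Type*} [MetricSpace X] (d : ℕ) (T : (Fin d → ℝ) → X → X) (L : ℝ)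
    {Ω : Type*} [MeasurableSpace Ω] (P : Measure Ω) (Xv : Ω → X) (Yv : Ω → L1Maps d L X) : ℝ :=
  ∫ ω, (L ^ d)⁻¹ * ∫ u, dist (T u (Xv ω)) (Yv ω u) ∂(boxMeasure d L) ∂P

/-- `R_L(𝐝, μ, ε)`: the infimum of `I(X;Y)` over all pairs of random variables on a common
probability space with `Law X = μ`, `Y` taking values in `L¹([0,L)^d, X)` and expected mean
distortion `< ε`. -/
def RL {X : Type*} [MetricSpace X] [MeasurableSpace X] (d : ℕ)
    (T : (Fin d → ℝ) → X → X) (μ : Measure X) (L ε : ℝ) : ℝ≥0∞ :=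
  ⨅ (Ω : Type) (_ : MeasurableSpace Ω) (P : Measure Ω) (_ : IsProbabilityMeasure P)
    (Xv : Ω → X) (Yv : Ω → L1Maps d L X) (_ : Measurable Xv) (_ : Measurable Yv)
    (_ : Measure.map Xv P = μ) (_ : distortion d T L P Xv Yv < ε),
    mutualInfo P Xv Yv

/-- The rate distortion function `R(𝐝, μ, ε) = lim_{L→∞} R_L(𝐝, μ, ε)/L^d`, which exists and
equals `inf_{L>0} R_L(𝐝, μ, ε)/L^d`. -/
def RD {X : Type*} [MetricSpace X] [MeasurableSpace X] (d : ℕ)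
    (T : (Fin d → ℝ) → X → X) (μ : Measure X) (ε : ℝ) : ℝ≥0∞ :=
  ⨅ (L : ℝ) (_ : 0 < L), RL d T μ L ε / ENNReal.ofReal (L ^ d)

/-- Upper rate distortion dimension. -/
def urdim {X : Type*} [MetricSpace X] [MeasurableSpace X] (d : ℕ)
    (T : (Fin d → ℝ) → X → X) (μ : Measure X) : ℝ≥0∞ :=
  Filter.limsup (fun ε : ℝ => RD d T μ ε / ENNReal.ofReal (Real.logb 2 (1 / ε))) (𝓝[>] (0 : ℝ))

/-- Lower rate distortion dimension. -/
def lrdim {X : Type*} [MetricSpace X] [MeasurableSpace X] (d : ℕ)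
    (T : (Fin d → ℝ) → X → X) (μ : Measure X) : ℝ≥0∞ :=
  Filter.liminf (fun ε : ℝ => RD d T μ ε / ENNReal.ofReal (Real.logb 2 (1 / ε))) (𝓝[>] (0 : ℝ))

/-- `μ` is invariant under the `ℝ^d`-action `T`. -/
def MeasInvariant {X : Type*} [MeasurableSpace X] (d : ℕ)
    (T : (Fin d → ℝ) → X → X) (μ : Measure X) : Prop :=
  ∀ u : Fin d → ℝ, Measure.map (T u) μ = μ

/-- `T` is a continuous action of the additive group `ℝ^d`. -/
def IsContAction {X : Type*} [TopologicalSpace X] (d : ℕ) (T : (Fin d → ℝ) → X → X) : Prop :=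
  Continuous (fun p : (Fin d → ℝ) × X => T p.1 p.2) ∧ (∀ x, T 0 x = x) ∧
    ∀ u v x, T (u + v) x = T u (T v x)

/-- The metric `𝐝_L(x,y) = sup_{u ∈ [0,L)^d} 𝐝(T^u x, T^u y)`. -/
def dSup {X : Type*} [MetricSpace X] (d : ℕ) (T : (Fin d → ℝ) → X → X) (L : ℝ) (x y : X) : ℝ :=
  ⨆ u : unitBox d L, dist (T u.1 x) (T u.1 y)

/-- The `ε`-covering number of `X` for the (pre)metric `ρ`: the minimal number of open sets
of `ρ`-diameter `< ε` covering `X`. -/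
def covNum (X : Type*) [TopologicalSpace X] (ρ : X → X → ℝ) (ε : ℝ) : ℕ :=
  sInf {n : ℕ | ∃ F : Finset (Set X), F.card = n ∧
    (∀ U ∈ F, IsOpen U ∧ (⨆ x ∈ U, ⨆ y ∈ U, ENNReal.ofReal (ρ x y)) < ENNReal.ofReal ε) ∧
    ⋃₀ (F : Set (Set X)) = Set.univ}

/-- The entropy at scale `ε`: `S(X,T,𝐝,ε) = lim_{L→∞} log₂ #(X, 𝐝_L, ε) / L^d`
(the limit exists, hence equals the limsup used here). -/
def entScale {X : Type*} [MetricSpace X] (d : ℕ) (T : (Fin d → ℝ) → X → X) (ε : ℝ) : ℝ≥0∞ :=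
  Filter.limsup
    (fun L : ℝ => ENNReal.ofReal (Real.logb 2 (covNum X (dSup d T L) ε) / L ^ d)) Filter.atTop

/-- The upper metric mean dimension. -/
def umdim {X : Type*} [MetricSpace X] (d : ℕ) (T : (Fin d → ℝ) → X → X) : ℝ≥0∞ :=
  Filter.limsup (fun ε : ℝ => entScale d T ε / ENNReal.ofReal (Real.logb 2 (1 / ε))) (𝓝[>] (0 : ℝ))

/-- The σ-algebra on the space of Borel probability measures on `X` (for a compact metric `X`
this is the Borel σ-algebra of the weak* topology). -/
instance ProbabilityMeasure.measurableSpace' {α : Type*} [MeasurableSpace α] :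
    MeasurableSpace (ProbabilityMeasure α) :=
  inferInstanceAs (MeasurableSpace {μ : Measure α // IsProbabilityMeasure μ})

/-- The space `M^T(X)` of `T`-invariant Borel probability measures on `X`. -/
abbrev InvM (X : Type*) [MeasurableSpace X] [MetricSpace X] (d : ℕ)
    (T : (Fin d → ℝ) → X → X) :=
  {ν : ProbabilityMeasure X // MeasInvariant d T (ν : Measure X)}

end


set_option linter.unusedSectionVars false

section helpers

variable {X : Type*} [MetricSpace X] [CompactSpace X] [MeasurableSpace X] [BorelSpace X]

/-- normalised distortion between a point and a path -/
noncomputable def rho {X : Type*} [MetricSpace X] (d : ℕ) (T : (Fin d → ℝ) → X → X) (L : ℝ)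
    (x : X) (y : L1Maps d L X) : ℝ :=
  (L ^ d)⁻¹ * ∫ u, dist (T u x) (y u) ∂(boxMeasure d L)

theorem volume_unitBox (d : ℕ) (L : ℝ) (hL : 0 < L) :
    volume (unitBox d L) = ENNReal.ofReal (L ^ d) := by
  unfold unitBox
  rw [volume_pi_pi]
  simp [ENNReal.ofReal_pow hL.le]

theorem measurableSet_unitBox (d : ℕ) (L : ℝ) : MeasurableSet (unitBox d L) :=
  MeasurableSet.univ_pi fun _ => measurableSet_Ico

theorem isFinite_boxMeasure (d : ℕ) (L : ℝ) (hL : 0 < L) :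
    IsFiniteMeasure (boxMeasure d L) := by
  constructor
  unfold boxMeasure
  rw [Measure.restrict_apply_univ, volume_unitBox d L hL]
  exact ENNReal.ofReal_lt_top

theorem boxMeasure_real_univ (d : ℕ) (L : ℝ) (hL : 0 < L) :
    (boxMeasure d L).real univ = L ^ d := by
  unfold boxMeasure Measure.real
  rw [Measure.restrict_apply_univ, volume_unitBox d L hL, ENNReal.toReal_ofReal (by positivity)]

theorem cont_T {d : ℕ} {T : (Fin d → ℝ) → X → X} (hT : IsContAction d T) (u : Fin d → ℝ) :
    Continuous (T u) := hT.1.comp (by fun_prop : Continuous fun x : X => (u, x))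

theorem cont_T' {d : ℕ} {T : (Fin d → ℝ) → X → X} (hT : IsContAction d T) (x : X) :
    Continuous (fun u => T u x) := hT.1.comp (by fun_prop : Continuous fun u : Fin d → ℝ => (u, x))

theorem dist_le_diam' (x y : X) : dist x y ≤ Metric.diam (univ : Set X) :=
  Metric.dist_le_diam_of_mem isCompact_univ.isBounded (mem_univ _) (mem_univ _)

theorem aesm_dist {d : ℕ} {T : (Fin d → ℝ) → X → X} (hT : IsContAction d T) (L : ℝ)
    (x : X) (y : L1Maps d L X) :
    AEStronglyMeasurable (fun u => dist (T u x) (y u)) (boxMeasure d L) :=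
  ((cont_T' hT x).aestronglyMeasurable).dist y.aestronglyMeasurable

theorem integrable_dist {d : ℕ} {T : (Fin d → ℝ) → X → X} (hT : IsContAction d T) (L : ℝ)
    (hL : 0 < L) (x : X) (y : L1Maps d L X) :
    Integrable (fun u => dist (T u x) (y u)) (boxMeasure d L) := by
  have := isFinite_boxMeasure d L hL
  refine Integrable.of_bound (aesm_dist hT L x y) (Metric.diam (univ : Set X)) ?_
  filter_upwards with u
  rw [Real.norm_of_nonneg dist_nonneg]
  exact dist_le_diam' _ _

theorem rho_nonneg {d : ℕ} {T : (Fin d → ℝ) → X → X} (L : ℝ)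
    (hL : 0 < L) (x : X) (y : L1Maps d L X) : 0 ≤ rho d T L x y := by
  unfold rho
  have : 0 ≤ ∫ u, dist (T u x) (y u) ∂(boxMeasure d L) := integral_nonneg fun _ => dist_nonneg
  positivity

theorem rho_le {d : ℕ} {T : (Fin d → ℝ) → X → X} (hT : IsContAction d T) (L : ℝ)
    (hL : 0 < L) (x : X) (y : L1Maps d L X) (C : ℝ)
    (hC : ∀ᵐ u ∂(boxMeasure d L), dist (T u x) (y u) ≤ C) : rho d T L x y ≤ C := by
  have := isFinite_boxMeasure d L hL
  unfold rho
  have h1 : ∫ u, dist (T u x) (y u) ∂(boxMeasure d L) ≤ ∫ u, C ∂(boxMeasure d L) :=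
    integral_mono_ae (integrable_dist hT L hL x y) (integrable_const _) hC
  rw [integral_const, boxMeasure_real_univ d L hL, smul_eq_mul] at h1
  have : (0 : ℝ) < L ^ d := by positivity
  rw [inv_mul_le_iff₀ this]
  exact h1

theorem rho_le_diam {d : ℕ} {T : (Fin d → ℝ) → X → X} (hT : IsContAction d T) (L : ℝ)
    (hL : 0 < L) (x : X) (y : L1Maps d L X) : rho d T L x y ≤ Metric.diam (univ : Set X) :=
  rho_le hT L hL x y _ (Eventually.of_forall fun _ => dist_le_diam' _ _)

theorem rho_le_add {d : ℕ} {T : (Fin d → ℝ) → X → X} (hT : IsContAction d T) (L : ℝ)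
    (hL : 0 < L) (x x' : X) (y : L1Maps d L X) (C : ℝ)
    (hC : ∀ u ∈ unitBox d L, dist (T u x) (T u x') ≤ C) :
    rho d T L x y ≤ rho d T L x' y + C := by
  have := isFinite_boxMeasure d L hL
  unfold rho
  have h1 : ∫ u, dist (T u x) (y u) ∂(boxMeasure d L) ≤
      ∫ u, (dist (T u x') (y u) + C) ∂(boxMeasure d L) := by
    refine integral_mono_ae (integrable_dist hT L hL x y)
      ((integrable_dist hT L hL x' y).add (integrable_const _)) ?_
    have : ∀ᵐ u ∂(boxMeasure d L), u ∈ unitBox d L :=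
      ae_restrict_mem (measurableSet_unitBox d L)
    filter_upwards [this] with u hu
    have := hC u hu
    have := dist_triangle (T u x) (T u x') (y u)
    linarith
  rw [integral_add (integrable_dist hT L hL x' y) (integrable_const _),
    integral_const, boxMeasure_real_univ d L hL, smul_eq_mul] at h1
  have : (0 : ℝ) < L ^ d := by positivity
  rw [inv_mul_le_iff₀ this, mul_add, ← mul_assoc, mul_inv_cancel₀ this.ne', one_mul]
  exact h1

theorem ofReal_rho {d : ℕ} {T : (Fin d → ℝ) → X → X} (hT : IsContAction d T) (L : ℝ)
    (hL : 0 < L) (x : X) (y : L1Maps d L X) :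
    ENNReal.ofReal (rho d T L x y) =
      (ENNReal.ofReal (L ^ d))⁻¹ * ∫⁻ u, ENNReal.ofReal (dist (T u x) (y u)) ∂(boxMeasure d L) := by
  have : (0 : ℝ) < L ^ d := by positivity
  unfold rho
  rw [ENNReal.ofReal_mul (by positivity), ENNReal.ofReal_inv_of_pos this,
    ofReal_integral_eq_lintegral_ofReal (integrable_dist hT L hL x y)
      (Eventually.of_forall fun _ => dist_nonneg)]

/-- uniform continuity of the action over the box -/
theorem unif_cont {d : ℕ} {T : (Fin d → ℝ) → X → X} (hT : IsContAction d T) (L : ℝ)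
    (δ : ℝ) (hδ : 0 < δ) : ∃ γ > 0, ∀ x x' : X, dist x x' < γ →
      ∀ u ∈ unitBox d L, dist (T u x) (T u x') ≤ δ := by
  have hK : IsCompact ((Set.univ.pi fun _ : Fin d => Set.Icc (0 : ℝ) L) ×ˢ (univ : Set X)) :=
    (isCompact_univ_pi fun _ => isCompact_Icc).prod isCompact_univ
  have := hK.uniformContinuousOn_of_continuous hT.1.continuousOn
  rw [Metric.uniformContinuousOn_iff] at this
  obtain ⟨γ, hγ, h⟩ := this δ hδ
  refine ⟨γ, hγ, fun x x' hx u hu => ?_⟩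
  have hu' : u ∈ (Set.univ.pi fun _ : Fin d => Set.Icc (0 : ℝ) L) :=
    fun i hi => ⟨(hu i hi).1, (hu i hi).2.le⟩
  exact (h (u, x) ⟨hu', mem_univ _⟩ (u, x') ⟨hu', mem_univ _⟩ (by simp [Prod.dist_eq, hγ, hx])).le

theorem continuous_rho {d : ℕ} {T : (Fin d → ℝ) → X → X} (hT : IsContAction d T) (L : ℝ)
    (hL : 0 < L) (y : L1Maps d L X) : Continuous fun x => rho d T L x y := by
  rw [Metric.continuous_iff]
  intro x δ hδ
  obtain ⟨γ, hγ, h⟩ := unif_cont hT L (δ / 2) (by positivity)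
  refine ⟨γ, hγ, fun x' hx' => ?_⟩
  have h1 := rho_le_add hT L hL x' x y _ (h x' x hx')
  have h2 := rho_le_add hT L hL x x' y _ (h x x' (by rwa [dist_comm]))
  rw [Real.dist_eq, abs_lt]
  constructor <;> linarith

/-- the orbit path of a point -/
noncomputable def orbitPath {d : ℕ} {T : (Fin d → ℝ) → X → X} (hT : IsContAction d T) (L : ℝ) (x : X) :
    L1Maps d L X := AEEqFun.mk (fun u => T u x) (cont_T' hT x).aestronglyMeasurable

theorem orbitPath_ae {d : ℕ} {T : (Fin d → ℝ) → X → X} (hT : IsContAction d T) (L : ℝ) (x : X) :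
    ∀ᵐ u ∂(boxMeasure d L), orbitPath hT L x u = T u x := AEEqFun.coeFn_mk _ _

theorem measurable_rho_right {d : ℕ} {T : (Fin d → ℝ) → X → X} (hT : IsContAction d T) (L : ℝ)
    (x : X) : Measurable fun y : L1Maps d L X => rho d T L x y := by
  have h : ∀ y : L1Maps d L X, rho d T L x y = (L ^ d)⁻¹ * L1dist (orbitPath hT L x) y := by
    intro y
    unfold rho L1dist
    congr 1
    refine integral_congr_ae ?_
    filter_upwards [orbitPath_ae hT L x] with u hu
    rw [hu]
  simp_rw [h]
  refine Measurable.const_mul ?_ _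
  refine measurable_of_Iio fun r => ?_
  exact MeasurableSpace.measurableSet_generateFrom ⟨_, r, rfl⟩

theorem measurable_rho {d : ℕ} {T : (Fin d → ℝ) → X → X} (hT : IsContAction d T) (L : ℝ)
    (hL : 0 < L) : Measurable fun p : X × L1Maps d L X => rho d T L p.1 p.2 := by
  have := stronglyMeasurable_uncurry_of_continuous_of_stronglyMeasurable
    (u := fun (x : X) (y : L1Maps d L X) => rho d T L x y)
    (fun y => continuous_rho hT L hL y) (fun x => (measurable_rho_right hT L x).stronglyMeasurable)
  exact this.measurable


/-- A finite channel from `X` to paths together with a reference output distribution. -/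
structure RDCode (X : Type*) [MetricSpace X] [MeasurableSpace X] (d : ℕ) (L : ℝ) where
  ι : Type
  fin : Fintype ι
  W : X → ι → ℝ
  hWm : ∀ j, Measurable fun x => W x j
  hW0 : ∀ x j, 0 ≤ W x j
  hW1 : ∀ x, ∑ j, W x j = 1
  q : ι → ℝ
  hq0 : ∀ j, 0 < q j
  hq1 : ∑ j, q j = 1
  y : ι → L1Maps d L X

attribute [instance] RDCode.fin

namespace RDCode

variable {d : ℕ} {L : ℝ}

/-- pointwise divergence -/
noncomputable def F (C : RDCode X d L) (x : X) : ℝ := ∑ j, C.W x j * Real.logb 2 (C.W x j / C.q j)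

/-- pointwise distortion -/
noncomputable def G (T : (Fin d → ℝ) → X → X) (C : RDCode X d L) (x : X) : ℝ :=
  ∑ j, C.W x j * rho d T L x (C.y j)

theorem measurable_F (C : RDCode X d L) : Measurable C.F := by
  unfold F
  refine Finset.measurable_sum _ fun j _ => ?_
  have := C.hWm j
  have h2 : Measurable fun x => Real.logb 2 (C.W x j / C.q j) := by
    unfold Real.logb
    exact (Real.measurable_log.comp (this.div_const _)).div_const _
  exact this.mul h2

theorem measurable_G {T : (Fin d → ℝ) → X → X} (hT : IsContAction d T) (hL : 0 < L)
    (C : RDCode X d L) : Measurable (C.G T) := by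
  unfold G
  refine Finset.measurable_sum _ fun j _ => ?_
  exact (C.hWm j).mul (continuous_rho hT L hL (C.y j)).measurable

theorem G_nonneg {T : (Fin d → ℝ) → X → X} (hL : 0 < L)
    (C : RDCode X d L) (x : X) : 0 ≤ C.G T x :=
  Finset.sum_nonneg fun j _ => mul_nonneg (C.hW0 x j) (rho_nonneg L hL x _)

end RDCode

/-- the tangent line inequality -/
theorem mul_logb_ge (w s : ℝ) (hw : 0 ≤ w) (hs : 0 < s) :
    (w - s) / Real.log 2 ≤ w * Real.logb 2 (w / s) := by
  unfold Real.logb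
  rw [← mul_div_assoc]
  refine div_le_div_of_nonneg_right ?_ (Real.log_nonneg (by norm_num))
  rcases hw.eq_or_lt with rfl | hw
  · simp [hs.le]
  · have h := Real.log_le_sub_one_of_pos (show 0 < s / w by positivity)
    have h2 : Real.log (w / s) = - Real.log (s / w) := by
      rw [← Real.log_inv, inv_div]
    rw [h2]
    have : w * (s / w) = s := by field_simp
    nlinarith

namespace RDCode
variable {d : ℕ} {L : ℝ}

theorem F_nonneg (C : RDCode X d L) (x : X) : 0 ≤ C.F x := by
  unfold F
  calc (0 : ℝ) = ∑ j, (C.W x j - C.q j) / Real.log 2 := by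
        rw [← Finset.sum_div, Finset.sum_sub_distrib, C.hW1, C.hq1]; simp
    _ ≤ _ := Finset.sum_le_sum fun j _ => mul_logb_ge _ _ (C.hW0 x j) (C.hq0 j)

theorem W_le_one (C : RDCode X d L) (x : X) (j : C.ι) : C.W x j ≤ 1 := by
  rw [← C.hW1 x]
  exact Finset.single_le_sum (f := fun j => C.W x j) (fun j _ => C.hW0 x j) (Finset.mem_univ j)

theorem F_term_le (C : RDCode X d L) (x : X) (j : C.ι) :
    |C.W x j * Real.logb 2 (C.W x j / C.q j)| ≤ (1 + |Real.log (C.q j)|) / Real.log 2 := by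
  unfold Real.logb
  have h0 := C.hW0 x j
  have h1 := C.W_le_one x j
  have hl : 0 < Real.log 2 := Real.log_pos (by norm_num)
  rw [← mul_div_assoc, abs_div, abs_of_pos hl]
  refine div_le_div_of_nonneg_right ?_ hl.le
  rcases h0.eq_or_lt with h | h
  · rw [← h]; simp; positivity
  · rw [Real.log_div h.ne' (C.hq0 j).ne', mul_sub]
    refine (abs_sub _ _).trans ?_
    have h2 := Real.abs_log_mul_self_lt _ h h1
    rw [mul_comm] at h2
    have h3 : |C.W x j * Real.log (C.q j)| ≤ |Real.log (C.q j)| := by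
      rw [abs_mul, abs_of_pos h]
      exact mul_le_of_le_one_left (abs_nonneg _) h1
    linarith

/-- rate of a code -/
noncomputable def J (C : RDCode X d L) (ν : Measure X) : ℝ≥0∞ := ∫⁻ x, ENNReal.ofReal (C.F x) ∂ν

/-- distortion of a code -/
noncomputable def D (T : (Fin d → ℝ) → X → X) (C : RDCode X d L) (ν : Measure X) : ℝ≥0∞ :=
  ∫⁻ x, ENNReal.ofReal (C.G T x) ∂ν

end RDCode

theorem sum_prod_marg {V ι : Type*} [Fintype V] [DecidableEq V] [Fintype ι] (A : V → ι → ℝ)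
    (hA : ∀ v, ∑ j, A v j = 1) (v0 : V) (h : ι → ℝ) :
    ∑ j : V → ι, (∏ v, A v (j v)) * h (j v0) = ∑ j, A v0 j * h j := by
  classical
  have h1 : ∀ j : V → ι, (∏ v, A v (j v)) * h (j v0) =
      ∏ v, (A v (j v) * if v = v0 then h (j v) else 1) := by
    intro j
    rw [Finset.prod_mul_distrib]
    congr 1
    rw [Finset.prod_ite_eq' Finset.univ v0 (fun v => h (j v))]
    simp
  simp_rw [h1]
  rw [← Fintype.prod_sum (fun v j => A v j * if v = v0 then h j else 1)]
  rw [Finset.prod_eq_single v0]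
  · simp
  · intro v _ hv
    simp [hv, hA]
  · simp

theorem sum_prod_one {V ι : Type*} [Fintype V] [DecidableEq V] [Fintype ι] (A : V → ι → ℝ)
    (hA : ∀ v, ∑ j, A v j = 1) :
    ∑ j : V → ι, (∏ v, A v (j v)) = 1 := by
  rw [← Fintype.prod_sum (fun v j => A v j)]
  simp [hA]


section concat

variable {d : ℕ} {L₀ : ℝ}

/-- translation vector -/
noncomputable def shiftV (L₀ : ℝ) {d N : ℕ} (v : Fin d → Fin N) : Fin d → ℝ := fun i => L₀ * (v i : ℕ)

/-- the box index of a point -/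
noncomputable def boxIdx (L₀ : ℝ) (d N : ℕ) [NeZero N] (u : Fin d → ℝ) : Fin d → Fin N :=
  fun i => Fin.ofNat N (⌊u i / L₀⌋₊)

theorem measurable_boxIdx (L₀ : ℝ) (d N : ℕ) [NeZero N] : Measurable (boxIdx L₀ d N) := by
  rw [measurable_pi_iff]
  intro i
  unfold boxIdx
  have h : Measurable fun u : Fin d → ℝ => ⌊u i / L₀⌋₊ :=
    Nat.measurable_floor.comp ((measurable_pi_apply i).div_const _)
  exact (measurable_from_top (f := fun n : ℕ => Fin.ofNat N n)).comp h

theorem boxIdx_eq (hL₀ : 0 < L₀) {N : ℕ} [NeZero N] (v : Fin d → Fin N) (u : Fin d → ℝ)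
    (hu : u - shiftV L₀ v ∈ unitBox d L₀) : boxIdx L₀ d N u = v := by
  funext i
  have h := hu i (mem_univ i)
  simp only [Pi.sub_apply, shiftV, mem_Ico] at h
  have h1 : ⌊u i / L₀⌋₊ = (v i : ℕ) := by
    rw [Nat.floor_eq_iff (by
      have : (0 : ℝ) ≤ L₀ * (v i : ℕ) := by positivity
      exact div_nonneg (by linarith) hL₀.le)]
    rw [le_div_iff₀ hL₀, div_lt_iff₀ hL₀]
    constructor <;> nlinarith
  unfold boxIdx
  rw [h1]
  ext
  simp [Fin.ofNat, Nat.mod_eq_of_lt (v i).2]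

theorem box_cover (hL₀ : 0 < L₀) {N : ℕ} [NeZero N] (L : ℝ) (hN : L ≤ N * L₀) :
    unitBox d L ⊆ ⋃ v : Fin d → Fin N, (fun u => u - shiftV L₀ v) ⁻¹' unitBox d L₀ := by
  intro u hu
  rw [mem_iUnion]
  refine ⟨boxIdx L₀ d N u, fun i hi => ?_⟩
  have h := hu i hi
  simp only [mem_Ico] at h
  have h0 : 0 ≤ u i / L₀ := div_nonneg h.1 hL₀.le
  have h1 : ⌊u i / L₀⌋₊ < N := by
    rw [Nat.floor_lt h0, div_lt_iff₀ hL₀]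
    linarith
  have h2 := Nat.floor_le h0
  have h3 := Nat.lt_floor_add_one (u i / L₀)
  rw [le_div_iff₀ hL₀] at h2
  rw [div_lt_iff₀ hL₀] at h3
  simp only [Pi.sub_apply, shiftV, boxIdx, Fin.ofNat, Nat.mod_eq_of_lt h1, mem_Ico]
  constructor <;> nlinarith

/-- concatenated path as a function -/
noncomputable def catFun {ι : Type} (y : ι → L1Maps d L₀ X) (N : ℕ) [NeZero N]
    (j : (Fin d → Fin N) → ι) (u : Fin d → ℝ) : X :=
  y (j (boxIdx L₀ d N u)) (u - shiftV L₀ (boxIdx L₀ d N u))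

theorem measurable_catFun {ι : Type} (y : ι → L1Maps d L₀ X) (N : ℕ) [NeZero N]
    (j : (Fin d → Fin N) → ι) : Measurable (catFun y N j) := by
  have h : Measurable fun p : (Fin d → Fin N) × (Fin d → ℝ) => y (j p.1) (p.2 - shiftV L₀ p.1) := by
    refine measurable_from_prod_countable_right fun v => ?_
    exact (y (j v)).measurable.comp (measurable_id.sub_const (shiftV L₀ v))
  exact h.comp ((measurable_boxIdx L₀ d N).prodMk measurable_id)

/-- concatenated path -/
noncomputable def catPath {ι : Type} (y : ι → L1Maps d L₀ X) (N : ℕ) [NeZero N] (L : ℝ)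
    (j : (Fin d → Fin N) → ι) : L1Maps d L X :=
  AEEqFun.mk (catFun y N j) (measurable_catFun y N j).aestronglyMeasurable

theorem rho_catPath {T : (Fin d → ℝ) → X → X} (hT : IsContAction d T) (hL₀ : 0 < L₀)
    {ι : Type} (y : ι → L1Maps d L₀ X) (N : ℕ) [NeZero N] (L : ℝ) (hL : 0 < L) (hN : L ≤ N * L₀)
    (j : (Fin d → Fin N) → ι) (x : X) :
    L ^ d * rho d T L x (catPath y N L j) ≤
      ∑ v, L₀ ^ d * rho d T L₀ (T (shiftV L₀ v) x) (y (j v)) := by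
  have key : ∀ (L : ℝ), 0 < L → ∀ (x : X) (z : L1Maps d L X), ENNReal.ofReal (L ^ d * rho d T L x z) =
      ∫⁻ u, ENNReal.ofReal (dist (T u x) (z u)) ∂(boxMeasure d L) := by
    intro L hL x z
    have hp : (0 : ℝ) < L ^ d := by positivity
    rw [ENNReal.ofReal_mul hp.le, ofReal_rho hT L hL, ← mul_assoc, ENNReal.mul_inv_cancel, one_mul]
    · simpa using hp
    · exact ENNReal.ofReal_ne_top
  have hnn : ∀ v, 0 ≤ L₀ ^ d * rho d T L₀ (T (shiftV L₀ v) x) (y (j v)) := fun v =>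
    mul_nonneg (by positivity) (rho_nonneg L₀ hL₀ _ _)
  rw [← ENNReal.ofReal_le_ofReal_iff (Finset.sum_nonneg fun v _ => hnn v),
    ENNReal.ofReal_sum_of_nonneg fun v _ => hnn v, key L hL]
  simp_rw [key L₀ hL₀]
  calc ∫⁻ u, ENNReal.ofReal (dist (T u x) (catPath y N L j u)) ∂(boxMeasure d L)
      = ∫⁻ u, ENNReal.ofReal (dist (T u x) (catFun y N j u)) ∂(boxMeasure d L) := by
        refine lintegral_congr_ae ?_
        filter_upwards [AEEqFun.coeFn_mk (μ := boxMeasure d L) (catFun y N j)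
          (measurable_catFun y N j).aestronglyMeasurable] with u hu
        unfold catPath
        rw [hu]
    _ ≤ ∫⁻ u in ⋃ v : Fin d → Fin N, (fun u => u - shiftV L₀ v) ⁻¹' unitBox d L₀,
          ENNReal.ofReal (dist (T u x) (catFun y N j u)) :=
        lintegral_mono_set (box_cover hL₀ L hN)
    _ ≤ ∑' v : Fin d → Fin N, ∫⁻ u in (fun u => u - shiftV L₀ v) ⁻¹' unitBox d L₀,
          ENNReal.ofReal (dist (T u x) (catFun y N j u)) := lintegral_iUnion_le _ _
    _ = ∑ v : Fin d → Fin N, ∫⁻ u in (fun u => u - shiftV L₀ v) ⁻¹' unitBox d L₀,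
          ENNReal.ofReal (dist (T u x) (catFun y N j u)) := tsum_fintype _
    _ = _ := by
        refine Finset.sum_congr rfl fun v _ => ?_
        have hmp := measurePreserving_sub_right (volume : Measure (Fin d → ℝ)) (shiftV L₀ v)
        have hme : MeasurableSet ((fun u => u - shiftV L₀ v) ⁻¹' unitBox d L₀) :=
          hmp.measurable (measurableSet_unitBox d L₀)
        have hmeas : Measurable fun w => ENNReal.ofReal
            (dist (T w (T (shiftV L₀ v) x)) (y (j v) w)) :=
          ENNReal.measurable_ofReal.comp
            ((cont_T' hT _).measurable.dist (y (j v)).measurable)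
        unfold boxMeasure
        have := hmp.setLIntegral_comp_preimage (measurableSet_unitBox d L₀) hmeas
        refine Eq.trans ?_ this
        refine setLIntegral_congr_fun hme fun u hu => ?_
        have hb := boxIdx_eq hL₀ v u hu
        simp only [catFun, hb]
        rw [← hT.2.2]
        simp

/-- concatenation of codes -/
noncomputable def RDCode.cat {T : (Fin d → ℝ) → X → X} (hT : IsContAction d T) (C : RDCode X d L₀)
    (N : ℕ) [NeZero N] (L : ℝ) : RDCode X d L where
  ι := (Fin d → Fin N) → C.ι
  fin := inferInstanceAs (Fintype ((Fin d → Fin N) → C.ι))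
  W := fun x j => ∏ v, C.W (T (shiftV L₀ v) x) (j v)
  hWm := fun j => Finset.measurable_prod _ fun v _ => (C.hWm (j v)).comp (cont_T hT _).measurable
  hW0 := fun x j => Finset.prod_nonneg fun v _ => C.hW0 _ _
  hW1 := fun x => sum_prod_one (fun (v : Fin d → Fin N) j => C.W (T (shiftV L₀ v) x) j) (fun v => C.hW1 _)
  q := fun j => ∏ v, C.q (j v)
  hq0 := fun j => Finset.prod_pos fun v _ => C.hq0 _
  hq1 := sum_prod_one (fun (v : Fin d → Fin N) j => C.q j) (fun v => C.hq1)
  y := fun j => catPath C.y N L j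

theorem RDCode.cat_F {T : (Fin d → ℝ) → X → X} (hT : IsContAction d T) (C : RDCode X d L₀)
    (N : ℕ) [NeZero N] (L : ℝ) (x : X) : (C.cat hT N L).F x = ∑ v : Fin d → Fin N, C.F (T (shiftV L₀ v) x) := by
  classical
  have h1 : (C.cat hT N L).F x = ∑ j : (Fin d → Fin N) → C.ι, ∑ v : Fin d → Fin N,
      (∏ v, C.W (T (shiftV L₀ v) x) (j v)) *
        Real.logb 2 (C.W (T (shiftV L₀ v) x) (j v) / C.q (j v)) := by
    refine Finset.sum_congr rfl fun j _ => ?_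
    change (∏ v, C.W (T (shiftV L₀ v) x) (j v)) * Real.logb 2
      ((∏ v, C.W (T (shiftV L₀ v) x) (j v)) / ∏ v, C.q (j v)) = _
    by_cases h : ∏ v, C.W (T (shiftV L₀ v) x) (j v) = 0
    · simp [h]
    · rw [← Finset.mul_sum, ← Finset.prod_div_distrib, Real.logb_prod]
      intro v _
      have := Finset.prod_ne_zero_iff.1 h v (Finset.mem_univ v)
      exact div_ne_zero this (C.hq0 _).ne'
  rw [h1, Finset.sum_comm]
  refine Finset.sum_congr rfl fun v _ => ?_
  exact sum_prod_marg (fun v j => C.W (T (shiftV L₀ v) x) j) (fun v => C.hW1 _) v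
    (fun j => Real.logb 2 (C.W (T (shiftV L₀ v) x) j / C.q j))

theorem RDCode.cat_G {T : (Fin d → ℝ) → X → X} (hT : IsContAction d T) (hL₀ : 0 < L₀) (C : RDCode X d L₀)
    (N : ℕ) [NeZero N] (L : ℝ) (hL : 0 < L) (hN : L ≤ N * L₀) (x : X) :
    L ^ d * (C.cat hT N L).G T x ≤ ∑ v : Fin d → Fin N, L₀ ^ d * C.G T (T (shiftV L₀ v) x) := by
  classical
  have h1 : L ^ d * (C.cat hT N L).G T x ≤ ∑ j : (Fin d → Fin N) → C.ι, ∑ v : Fin d → Fin N,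
      (∏ v, C.W (T (shiftV L₀ v) x) (j v)) *
        (L₀ ^ d * rho d T L₀ (T (shiftV L₀ v) x) (C.y (j v))) := by
    unfold RDCode.G
    rw [Finset.mul_sum]
    have h2 : ∀ j : (Fin d → Fin N) → C.ι, L ^ d * ((C.cat hT N L).W x j *
        rho d T L x ((C.cat hT N L).y j)) ≤ ∑ v : Fin d → Fin N,
      (∏ v, C.W (T (shiftV L₀ v) x) (j v)) *
        (L₀ ^ d * rho d T L₀ (T (shiftV L₀ v) x) (C.y (j v))) := by
      intro j
      rw [← Finset.mul_sum, mul_left_comm]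
      exact mul_le_mul_of_nonneg_left (rho_catPath hT hL₀ C.y N L hL hN j x)
        ((C.cat hT N L).hW0 x j)
    exact Finset.sum_le_sum fun j _ => h2 j
  refine h1.trans_eq ?_
  rw [Finset.sum_comm]
  refine Finset.sum_congr rfl fun v _ => ?_
  rw [sum_prod_marg (fun v j => C.W (T (shiftV L₀ v) x) j) (fun v => C.hW1 _) v
    (fun j => L₀ ^ d * rho d T L₀ (T (shiftV L₀ v) x) (C.y j))]
  unfold RDCode.G
  rw [Finset.mul_sum]
  exact Finset.sum_congr rfl fun j _ => by ring

theorem lintegral_inv {T : (Fin d → ℝ) → X → X} (hT : IsContAction d T) (ν : Measure X)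
    (hν : MeasInvariant d T ν) (g : X → ℝ≥0∞) (hg : Measurable g) (u : Fin d → ℝ) :
    ∫⁻ x, g (T u x) ∂ν = ∫⁻ x, g x ∂ν := by
  conv_rhs => rw [← hν u]
  rw [lintegral_map hg (cont_T hT u).measurable]

theorem RDCode.cat_J {T : (Fin d → ℝ) → X → X} (hT : IsContAction d T) (C : RDCode X d L₀)
    (N : ℕ) [NeZero N] (L : ℝ) (ν : Measure X)
    (hν : MeasInvariant d T ν) : (C.cat hT N L).J ν = (N : ℝ≥0∞) ^ d * C.J ν := by
  unfold RDCode.J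
  simp_rw [C.cat_F hT N L]
  have hm : Measurable fun x => ENNReal.ofReal (C.F x) := C.measurable_F.ennreal_ofReal
  simp_rw [ENNReal.ofReal_sum_of_nonneg fun v _ => C.F_nonneg _]
  have hm' : ∀ v : Fin d → Fin N, Measurable fun x => ENNReal.ofReal (C.F (T (shiftV L₀ v) x)) :=
    fun v => hm.comp (cont_T hT _).measurable
  rw [lintegral_finsetSum _ fun v _ => hm' v]
  have hi := fun v : Fin d → Fin N => lintegral_inv hT ν hν _ hm (shiftV L₀ v)
  simp_rw [hi]
  simp

theorem RDCode.cat_D {T : (Fin d → ℝ) → X → X} (hT : IsContAction d T) (hL₀ : 0 < L₀) (C : RDCode X d L₀)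
    (N : ℕ) [NeZero N] (L : ℝ) (hL : 0 < L) (hN : L ≤ N * L₀) (ν : Measure X)
    (hν : MeasInvariant d T ν) :
    ENNReal.ofReal (L ^ d) * (C.cat hT N L).D T ν ≤
      (N : ℝ≥0∞) ^ d * (ENNReal.ofReal (L₀ ^ d) * C.D T ν) := by
  unfold RDCode.D
  have hm : Measurable fun x => ENNReal.ofReal (C.G T x) := (C.measurable_G hT hL₀).ennreal_ofReal
  rw [← lintegral_const_mul' _ _ ENNReal.ofReal_ne_top]
  calc _ ≤ ∫⁻ x, ∑ v : Fin d → Fin N, ENNReal.ofReal (L₀ ^ d) * ENNReal.ofReal (C.G T (T (shiftV L₀ v) x)) ∂ν := by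
        refine lintegral_mono fun x => ?_
        simp_rw [← ENNReal.ofReal_mul (show 0 ≤ L ^ d by positivity),
          ← ENNReal.ofReal_mul (show 0 ≤ L₀ ^ d by positivity)]
        rw [← ENNReal.ofReal_sum_of_nonneg fun v _ =>
          mul_nonneg (by positivity) (C.G_nonneg hL₀ _)]
        exact ENNReal.ofReal_le_ofReal (C.cat_G hT hL₀ N L hL hN x)
    _ = _ := by
        have hm' : ∀ v : Fin d → Fin N, Measurable fun x => ENNReal.ofReal (C.G T (T (shiftV L₀ v) x)) :=
          fun v => hm.comp (cont_T hT _).measurable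
        have hi := fun v : Fin d → Fin N => lintegral_inv hT ν hν _ hm (shiftV L₀ v)
        rw [lintegral_finsetSum _ fun v _ => (hm' v).const_mul _]
        simp_rw [lintegral_const_mul' _ _ ENNReal.ofReal_ne_top, hi]
        simp

end concat


theorem mul_logb_div3 (r a b : ℝ) (ha : r ≠ 0 → a ≠ 0) (hb : r ≠ 0 → b ≠ 0) :
    r * Real.logb 2 (r / (a * b)) =
      r * Real.logb 2 r - r * Real.logb 2 a - r * Real.logb 2 b := by
  by_cases h : r = 0
  · simp [h]
  · rw [Real.logb_div h (mul_ne_zero (ha h) (hb h)), Real.logb_mul (ha h) (hb h)]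
    ring

/-- `H(A)+H(B)-H(A,B)` in terms of the joint distribution -/
theorem ent_formula {Ω : Type*} [MeasurableSpace Ω] (P : Measure Ω) [IsProbabilityMeasure P]
    {n m : ℕ} (A : Ω → Fin n) (hA : Measurable A) (B : Ω → Fin m) (hB : Measurable B) :
    shannonEntropy P A + shannonEntropy P B - shannonEntropy P (fun ω => (A ω, B ω)) =
      ∑ a, ∑ b, P.real (A ⁻¹' {a} ∩ B ⁻¹' {b}) *
        Real.logb 2 (P.real (A ⁻¹' {a} ∩ B ⁻¹' {b}) / (P.real (A ⁻¹' {a}) * P.real (B ⁻¹' {b}))) := by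
  have hA' : ∀ a, MeasurableSet (A ⁻¹' {a}) := fun a => hA (measurableSet_singleton a)
  have hB' : ∀ b, MeasurableSet (B ⁻¹' {b}) := fun b => hB (measurableSet_singleton b)
  have key : ∀ (k : ℕ) (D : Ω → Fin k) (_ : Measurable D) (S : Set Ω) (_ : MeasurableSet S),
      P.real S = ∑ b, P.real (S ∩ D ⁻¹' {b}) := by
    intro k D hD S hS
    rw [← measureReal_biUnion_finset]
    · congr 1
      ext ω
      simp
    · intro i _ j _ hij
      refine Disjoint.mono inter_subset_right inter_subset_right ?_
      exact Disjoint.preimage _ (by simpa using hij)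
    · intro b _
      exact hS.inter (hD (measurableSet_singleton b))
  have e1 : shannonEntropy P A = -∑ a, ∑ b, P.real (A ⁻¹' {a} ∩ B ⁻¹' {b}) *
      Real.logb 2 (P.real (A ⁻¹' {a})) := by
    unfold shannonEntropy
    congr 1
    refine Finset.sum_congr rfl fun a _ => ?_
    rw [← Finset.sum_mul, ← key m B hB _ (hA' a)]
    rfl
  have e2 : shannonEntropy P B = -∑ a, ∑ b, P.real (A ⁻¹' {a} ∩ B ⁻¹' {b}) *
      Real.logb 2 (P.real (B ⁻¹' {b})) := by
    unfold shannonEntropy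
    rw [Finset.sum_comm]
    congr 1
    refine Finset.sum_congr rfl fun b _ => ?_
    rw [← Finset.sum_mul]
    simp_rw [inter_comm _ (B ⁻¹' {b})]
    rw [← key n A hA _ (hB' b)]
    rfl
  have e3 : shannonEntropy P (fun ω => (A ω, B ω)) =
      -∑ a, ∑ b, P.real (A ⁻¹' {a} ∩ B ⁻¹' {b}) *
      Real.logb 2 (P.real (A ⁻¹' {a} ∩ B ⁻¹' {b})) := by
    unfold shannonEntropy
    rw [Fintype.sum_prod_type]
    congr 1
    refine Finset.sum_congr rfl fun a _ => Finset.sum_congr rfl fun b _ => ?_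
    have : (fun ω => (A ω, B ω)) ⁻¹' {(a, b)} = A ⁻¹' {a} ∩ B ⁻¹' {b} := by
      ext ω; simp
    rw [this]
    rfl
  rw [e1, e2, e3]
  have : ∀ a b, P.real (A ⁻¹' {a} ∩ B ⁻¹' {b}) *
        Real.logb 2 (P.real (A ⁻¹' {a} ∩ B ⁻¹' {b}) / (P.real (A ⁻¹' {a}) * P.real (B ⁻¹' {b}))) =
      P.real (A ⁻¹' {a} ∩ B ⁻¹' {b}) * Real.logb 2 (P.real (A ⁻¹' {a} ∩ B ⁻¹' {b})) -
      P.real (A ⁻¹' {a} ∩ B ⁻¹' {b}) * Real.logb 2 (P.real (A ⁻¹' {a})) -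
      P.real (A ⁻¹' {a} ∩ B ⁻¹' {b}) * Real.logb 2 (P.real (B ⁻¹' {b})) := by
    intro a b
    refine mul_logb_div3 _ _ _ (fun h h' => h ?_) (fun h h' => h ?_)
    · exact le_antisymm (h' ▸ measureReal_mono inter_subset_left) measureReal_nonneg
    · exact le_antisymm (h' ▸ measureReal_mono inter_subset_right) measureReal_nonneg
  simp_rw [this, Finset.sum_sub_distrib]
  ring

theorem gibbs_fin {ι κ : Type*} [Fintype ι] [Fintype κ] {m : ℕ} (r c M : ι → κ → ℝ) (Q : ι → ℝ)
    (β : ι → Fin m) (hr : ∀ j a, 0 ≤ r j a) (hr1 : ∑ a, ∑ j, r j a = 1)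
    (hQ : ∀ j, 0 ≤ Q j) (hQ1 : ∑ j, Q j ≤ 1)
    (hM0 : ∀ j a, 0 ≤ M j a) (hM : ∀ j a, M j a ≤ ∑ i, r i a)
    (hc0 : ∀ j a, r j a = 0 → 0 ≤ c j a)
    (hc : ∀ j a (θ : ℝ), 0 < θ →
      r j a * Real.logb 2 θ ≤ c j a - (r j a - Q j * θ * M j a) / Real.log 2) :
    ∑ a, ∑ b, (∑ j, if β j = b then r j a else 0) *
      Real.logb 2 ((∑ j, if β j = b then r j a else 0) /
        ((∑ j, r j a) * (∑ a', ∑ j, if β j = b then r j a' else 0))) ≤ ∑ j, ∑ a, c j a := by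
  have hl : 0 < Real.log 2 := Real.log_pos (by norm_num)
  set rab : κ → Fin m → ℝ := fun a b => ∑ j, if β j = b then r j a else 0 with hrab
  set ra : κ → ℝ := fun a => ∑ j, r j a with hra
  set rb : Fin m → ℝ := fun b => ∑ a, rab a b with hrb
  set θ : κ → Fin m → ℝ := fun a b => rab a b / (ra a * rb b) with hθ
  have hrab0 : ∀ a b, 0 ≤ rab a b := fun a b => Finset.sum_nonneg fun j _ => by
    split_ifs
    · exact hr j a
    · exact le_rfl
  have hra0 : ∀ a, 0 ≤ ra a := fun a => Finset.sum_nonneg fun j _ => hr j a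
  have hrb0 : ∀ b, 0 ≤ rb b := fun b => Finset.sum_nonneg fun a _ => hrab0 a b
  have hθ0 : ∀ a b, 0 ≤ θ a b := fun a b => div_nonneg (hrab0 a b) (mul_nonneg (hra0 a) (hrb0 b))
  have hjab : ∀ j a, r j a ≤ rab a (β j) := fun j a => by
    have := Finset.single_le_sum (f := fun i => if β i = β j then r i a else 0)
      (fun i _ => by
        split_ifs
        · exact hr i a
        · exact le_rfl) (Finset.mem_univ j)
    simpa using this
  have hja : ∀ j a, r j a ≤ ra a := fun j a =>
    Finset.single_le_sum (f := fun i => r i a) (fun i _ => hr i a) (Finset.mem_univ j)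
  have hjb : ∀ a b, rab a b ≤ rb b := fun a b =>
    Finset.single_le_sum (f := fun a => rab a b) (fun i _ => hrab0 i b) (Finset.mem_univ a)
  have h1 : ∑ a, ∑ b, rab a b * Real.logb 2 (θ a b) =
      ∑ a, ∑ j, r j a * Real.logb 2 (θ a (β j)) := by
    refine Finset.sum_congr rfl fun a _ => ?_
    simp_rw [hrab, Finset.sum_mul]
    rw [Finset.sum_comm]
    refine Finset.sum_congr rfl fun j _ => ?_
    simp only [ite_mul, zero_mul]
    rw [Finset.sum_ite_eq]
    simp
  have h2 : ∀ j a, r j a * Real.logb 2 (θ a (β j)) ≤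
      c j a - (r j a - Q j * θ a (β j) * M j a) / Real.log 2 := by
    intro j a
    rcases (hr j a).eq_or_lt with h | h
    · rw [← h]
      have h3 := hc0 j a h.symm
      have h4 : 0 ≤ Q j * θ a (β j) * M j a / Real.log 2 := by
        have := hQ j; have := hθ0 a (β j); have := hM0 j a
        positivity
      rw [zero_sub, neg_div]
      linarith
    · refine hc j a _ ?_
      have := hjab j a
      have := hja j a
      have := hjb a (β j)
      exact div_pos (by linarith) (mul_pos (by linarith) (by linarith))
  have h3 : ∀ j a, Q j * θ a (β j) * M j a ≤ Q j * (rab a (β j) / rb (β j)) := by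
    intro j a
    rw [mul_assoc]
    refine mul_le_mul_of_nonneg_left ?_ (hQ j)
    have hh : θ a (β j) * ra a ≤ rab a (β j) / rb (β j) := by
      simp only [hθ]
      rcases (hra0 a).eq_or_lt with h | h
      · rw [← h]; simpa using div_nonneg (hrab0 a _) (hrb0 _)
      · rw [div_mul_eq_mul_div, mul_comm (ra a) (rb _), mul_div_mul_right _ _ h.ne']
    exact (mul_le_mul_of_nonneg_left (hM j a) (hθ0 _ _)).trans hh
  have h4 : ∑ a, ∑ j, Q j * θ a (β j) * M j a ≤ 1 := by
    rw [Finset.sum_comm]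
    refine le_trans (Finset.sum_le_sum fun j _ => ?_) hQ1
    calc ∑ a, Q j * θ a (β j) * M j a ≤ ∑ a, Q j * (rab a (β j) / rb (β j)) :=
          Finset.sum_le_sum fun a _ => h3 j a
      _ = Q j * (rb (β j) / rb (β j)) := by rw [← Finset.mul_sum, ← Finset.sum_div]
      _ ≤ Q j * 1 := mul_le_mul_of_nonneg_left (div_self_le_one _) (hQ j)
      _ = Q j := mul_one _
  calc ∑ a, ∑ b, rab a b * Real.logb 2 (θ a b) = _ := h1
    _ ≤ ∑ a, ∑ j, (c j a - (r j a - Q j * θ a (β j) * M j a) / Real.log 2) :=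
        Finset.sum_le_sum fun a _ => Finset.sum_le_sum fun j _ => h2 j a
    _ = ∑ a, ∑ j, c j a - (∑ a, ∑ j, r j a - ∑ a, ∑ j, Q j * θ a (β j) * M j a) / Real.log 2 := by
        simp_rw [Finset.sum_sub_distrib, ← Finset.sum_div, Finset.sum_sub_distrib]
    _ ≤ ∑ a, ∑ j, c j a := by
        rw [hr1]
        have : 0 ≤ (1 - ∑ a, ∑ j, Q j * θ a (β j) * M j a) / Real.log 2 :=
          div_nonneg (by linarith) hl.le
        linarith
    _ = _ := Finset.sum_comm


theorem mul_logb_bdd (w Q : ℝ) (h0 : 0 ≤ w) (h1 : w ≤ 1) (hQ : 0 < Q) :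
    |w * Real.logb 2 (w / Q)| ≤ (1 + |Real.log Q|) / Real.log 2 := by
  unfold Real.logb
  have hl : 0 < Real.log 2 := Real.log_pos (by norm_num)
  rw [← mul_div_assoc, abs_div, abs_of_pos hl]
  refine div_le_div_of_nonneg_right ?_ hl.le
  rcases h0.eq_or_lt with h | h
  · rw [← h]; simp; positivity
  · rw [Real.log_div h.ne' hQ.ne', mul_sub]
    refine (abs_sub _ _).trans ?_
    have h2 := Real.abs_log_mul_self_lt _ h h1
    rw [mul_comm] at h2
    have h3 : |w * Real.log Q| ≤ |Real.log Q| := by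
      rw [abs_mul, abs_of_pos h]
      exact mul_le_of_le_one_left (abs_nonneg _) h1
    linarith

theorem measurable_mul_logb {w : X → ℝ} (hw : Measurable w) (Q : ℝ) :
    Measurable fun x => w x * Real.logb 2 (w x / Q) := by
  unfold Real.logb
  exact hw.mul ((Real.measurable_log.comp (hw.div_const _)).div_const _)

theorem integrable_mul_logb {w : X → ℝ} (hw : Measurable w) (h0 : ∀ x, 0 ≤ w x) (h1 : ∀ x, w x ≤ 1)
    (Q : ℝ) (hQ : 0 < Q) (ν : Measure X) [IsFiniteMeasure ν] :
    Integrable (fun x => w x * Real.logb 2 (w x / Q)) ν := by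
  refine Integrable.of_bound (measurable_mul_logb hw Q).aestronglyMeasurable
    ((1 + |Real.log Q|) / Real.log 2) (Eventually.of_forall fun x => ?_)
  rw [Real.norm_eq_abs]
  exact mul_logb_bdd _ _ (h0 x) (h1 x) hQ

theorem gibbs_set {w : X → ℝ} (hw : Measurable w) (h0 : ∀ x, 0 ≤ w x) (h1 : ∀ x, w x ≤ 1)
    (Q : ℝ) (hQ : 0 < Q) (ν : Measure X) [IsFiniteMeasure ν] (A : Set X) (θ : ℝ) (hθ : 0 < θ) :
    (∫ x in A, w x ∂ν) * Real.logb 2 θ ≤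
      ∫ x in A, w x * Real.logb 2 (w x / Q) ∂ν -
        ((∫ x in A, w x ∂ν) - Q * θ * ν.real A) / Real.log 2 := by
  have hwi : Integrable w (ν.restrict A) :=
    Integrable.of_bound hw.aestronglyMeasurable 1 (Eventually.of_forall fun x => by
      rw [Real.norm_of_nonneg (h0 x)]; exact h1 x)
  have hgi := integrable_mul_logb hw h0 h1 Q hQ (ν.restrict A)
  have hsi : Integrable (fun x => (w x - Q * θ) / Real.log 2) (ν.restrict A) :=
    (hwi.sub (integrable_const _)).div_const _
  have h := integral_mono (μ := ν.restrict A) (hwi.mul_const (Real.logb 2 θ)) (hgi.sub hsi) (by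
    intro x
    simp only [Pi.sub_apply]
    have h3 := mul_logb_ge (w x) (Q * θ) (h0 x) (by positivity)
    have h4 : w x * Real.logb 2 (w x / (Q * θ)) =
        w x * Real.logb 2 (w x / Q) - w x * Real.logb 2 θ := by
      by_cases hx : w x = 0
      · simp [hx]
      · rw [← div_div, Real.logb_div (div_ne_zero hx hQ.ne') hθ.ne', mul_sub]
    linarith)
  rw [integral_mul_const, integral_sub' hgi hsi, integral_div, integral_sub hwi (integrable_const _),
    integral_const, smul_eq_mul, measureReal_restrict_apply_univ] at h
  rw [mul_comm (Q * θ)]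
  exact h

/-- achievability, flattened -/
theorem ach_flat {d : ℕ} {T : (Fin d → ℝ) → X → X} (hT : IsContAction d T) {L : ℝ} (hL : 0 < L)
    {ι : Type} [Fintype ι] (μ : Measure X) [IsProbabilityMeasure μ] (m : ι → Measure X)
    (hm : ∀ j, m j ≤ μ) (w : ι → X → ℝ) (hw : ∀ j, Measurable (w j)) (h0 : ∀ j x, 0 ≤ w j x)
    (h1 : ∀ j x, w j x ≤ 1)
    (hsum : ∑ j, (m j).withDensity (fun x => ENNReal.ofReal (w j x)) = μ)
    (Q : ι → ℝ) (hQ : ∀ j, 0 < Q j) (hQ1 : ∑ j, Q j ≤ 1) (y : ι → L1Maps d L X) (ε : ℝ)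
    (hε : ∑ j, ∫⁻ x, ENNReal.ofReal (w j x * rho d T L x (y j)) ∂(m j) < ENNReal.ofReal ε) :
    RL d T μ L ε ≤ ENNReal.ofReal (∑ j, ∫ x, w j x * Real.logb 2 (w j x / Q j) ∂(m j)) := by
  classical
  have hmf : ∀ j, IsFiniteMeasure (m j) := fun j => isFiniteMeasure_of_le μ (hm j)
  set M : ι → Measure X := fun j => (m j).withDensity (fun x => ENNReal.ofReal (w j x)) with hM
  have hMle : ∀ j, M j ≤ μ := fun j => by
    rw [← hsum]
    intro A
    rw [Measure.finsetSum_apply]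
    exact Finset.single_le_sum (f := fun j => M j A) (fun _ _ => bot_le) (Finset.mem_univ j)
  have hMf : ∀ j, IsFiniteMeasure (M j) := fun j => isFiniteMeasure_of_le μ (hMle j)
  obtain ⟨s, hs, ⟨e⟩⟩ := exists_subset_real_measurableEquiv X
  let _ : MeasurableSpace ι := ⊤
  have hem : ∀ j : ι, Measurable fun x : X => (e x, j) := fun j => e.measurable.prodMk measurable_const
  set P : Measure (s × ι) := ∑ j, (M j).map (fun x => (e x, j)) with hP
  have hPapp : ∀ S : Set (s × ι), MeasurableSet S → P S = ∑ j, M j {x | (e x, j) ∈ S} := by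
    intro S hS
    rw [hP, Measure.finsetSum_apply]
    refine Finset.sum_congr rfl fun j _ => ?_
    rw [Measure.map_apply (hem j) hS]
    rfl
  have hXm : Measurable fun ω : s × ι => e.symm ω.1 := e.symm.measurable.comp measurable_fst
  have hYm : Measurable fun ω : s × ι => y ω.2 :=
    (measurable_from_top (f := y)).comp measurable_snd
  have hmap : Measure.map (fun ω : s × ι => e.symm ω.1) P = μ := by
    ext A hA
    rw [Measure.map_apply hXm hA, hPapp _ (hXm hA), ← hsum, Measure.finsetSum_apply]
    simp
    rfl
  have hPp : IsProbabilityMeasure P := by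
    constructor
    have : μ univ = P univ := by rw [← hmap, Measure.map_apply hXm MeasurableSet.univ]; rfl
    rw [← this]
    exact measure_univ
  have hdist : distortion d T L P (fun ω : s × ι => e.symm ω.1) (fun ω => y ω.2) < ε := by
    have hmeas : Measurable fun ω : s × ι => rho d T L (e.symm ω.1) (y ω.2) :=
      (measurable_rho hT L hL).comp (hXm.prodMk hYm)
    have hε0 : 0 < ε := by
      by_contra h
      rw [ENNReal.ofReal_of_nonpos (not_lt.1 h)] at hε
      exact not_lt_zero hε
    change ∫ ω, rho d T L (e.symm ω.1) (y ω.2) ∂P < ε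
    rw [integral_eq_lintegral_of_nonneg_ae (Eventually.of_forall fun ω => rho_nonneg L hL _ _)
      hmeas.aestronglyMeasurable]
    refine (ENNReal.lt_ofReal_iff_toReal_lt ?_).1 ?_
    · have : ∫⁻ ω, ENNReal.ofReal (rho d T L (e.symm ω.1) (y ω.2)) ∂P ≤
          ∫⁻ ω, ENNReal.ofReal (Metric.diam (univ : Set X)) ∂P :=
        lintegral_mono fun ω => ENNReal.ofReal_le_ofReal (rho_le_diam hT L hL _ _)
      refine (this.trans_lt ?_).ne
      simp
    · refine lt_of_eq_of_lt ?_ hε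
      rw [hP, lintegral_finsetSum_measure]
      refine Finset.sum_congr rfl fun j _ => ?_
      have hmj : Measurable fun x => ENNReal.ofReal (rho d T L (e.symm (e x, j).1) (y (e x, j).2)) :=
        hmeas.ennreal_ofReal.comp (hem j)
      rw [lintegral_map hmeas.ennreal_ofReal (hem j)]
      simp only [hM]
      rw [lintegral_withDensity_eq_lintegral_mul _ (hw j).ennreal_ofReal hmj]
      refine lintegral_congr fun x => ?_
      simp [ENNReal.ofReal_mul (h0 j x)]
  have hle : RL d T μ L ε ≤ mutualInfo P (fun ω : s × ι => e.symm ω.1) (fun ω => y ω.2) := by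
    unfold RL
    refine iInf_le_of_le (s × ι) (iInf_le_of_le inferInstance (iInf_le_of_le P
      (iInf_le_of_le hPp (iInf_le_of_le _ (iInf_le_of_le _ (iInf_le_of_le hXm
      (iInf_le_of_le hYm (iInf_le_of_le hmap (iInf_le_of_le hdist le_rfl)))))))))
  refine hle.trans ?_
  unfold mutualInfo
  refine iSup_le fun n => iSup_le fun m' => iSup_le fun α => iSup_le fun hα => iSup_le fun β =>
    iSup_le fun hβ => ENNReal.ofReal_le_ofReal ?_
  have hαX : Measurable fun ω : s × ι => α (e.symm ω.1) := hα.comp hXm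
  have hβY : Measurable fun ω : s × ι => β (y ω.2) := hβ.comp hYm
  have hef := ent_formula P _ hαX _ hβY
  refine hef.trans_le ?_
  have hαm : ∀ a, MeasurableSet (α ⁻¹' {a}) := fun a => hα (measurableSet_singleton a)
  set r : ι → Fin n → ℝ := fun j a => (M j).real (α ⁻¹' {a}) with hr
  have hrI : ∀ j a, r j a = ∫ x in α ⁻¹' {a}, w j x ∂(m j) := by
    intro j a
    rw [integral_eq_lintegral_of_nonneg_ae (Eventually.of_forall fun x => h0 j x)
      (hw j).aestronglyMeasurable]
    simp only [hr, hM, Measure.real]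
    rw [withDensity_apply _ (hαm a)]
  have eab : ∀ a b, P.real ((fun ω : s × ι => α (e.symm ω.1)) ⁻¹' {a} ∩ (fun ω => β (y ω.2)) ⁻¹' {b}) =
      ∑ j, if β (y j) = b then r j a else 0 := by
    intro a b
    unfold Measure.real
    rw [hPapp _ ((hαX (measurableSet_singleton a)).inter
      (hβY (measurableSet_singleton b))), ENNReal.toReal_sum (fun j _ => measure_ne_top _ _)]
    refine Finset.sum_congr rfl fun j _ => ?_
    split_ifs with h
    · simp [h, hr, Measure.real]; rfl
    · simp [h]
  have ea : ∀ a, P.real ((fun ω : s × ι => α (e.symm ω.1)) ⁻¹' {a}) = ∑ j, r j a := by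
    intro a
    unfold Measure.real
    rw [hPapp _ (hαX (measurableSet_singleton a)),
      ENNReal.toReal_sum (fun j _ => measure_ne_top _ _)]
    refine Finset.sum_congr rfl fun j _ => ?_
    simp [hr, Measure.real]; rfl
  have hsumα : ∀ ν : Measure X, IsFiniteMeasure ν → ∑ a, ν.real (α ⁻¹' {a}) = ν.real univ := by
    intro ν hν
    rw [← measureReal_biUnion_finset]
    · congr 1
      ext ω
      simp
    · intro i _ j _ hij
      exact Disjoint.preimage _ (by simpa using hij)
    · intro b _
      exact hαm b
  have eb : ∀ b, P.real ((fun ω : s × ι => β (y ω.2)) ⁻¹' {b}) =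
      ∑ a, ∑ j, if β (y j) = b then r j a else 0 := by
    intro b
    unfold Measure.real
    rw [hPapp _ (hβY (measurableSet_singleton b)),
      ENNReal.toReal_sum (fun j _ => measure_ne_top _ _), Finset.sum_comm]
    refine Finset.sum_congr rfl fun j _ => ?_
    split_ifs with h
    · have := hsumα (M j) (hMf j)
      rw [this]
      simp [h, Measure.real]
    · simp [h]
  have era : ∀ a, ∑ j, r j a = μ.real (α ⁻¹' {a}) := by
    intro a
    unfold Measure.real
    rw [← hsum, Measure.finsetSum_apply, ENNReal.toReal_sum (fun j _ => measure_ne_top _ _)]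
    rfl
  simp_rw [eab, ea, eb]
  have hfin := gibbs_fin r (fun j a => ∫ x in α ⁻¹' {a}, w j x * Real.logb 2 (w j x / Q j) ∂(m j))
    (fun j a => (m j).real (α ⁻¹' {a})) Q (fun j => β (y j)) (fun j a => measureReal_nonneg)
    (by simp_rw [era]; rw [hsumα μ inferInstance]; simp) (fun j => (hQ j).le) hQ1
    (fun j a => measureReal_nonneg)
    (fun j a => by
      rw [era]
      exact ENNReal.toReal_mono (measure_ne_top _ _) (hm j _))
    (fun j a hja => by
      have hg := gibbs_set (hw j) (h0 j) (h1 j) (Q j) (hQ j) (m j) (α ⁻¹' {a})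
      rw [← hrI, hja] at hg
      set c := ∫ x in α ⁻¹' {a}, w j x * Real.logb 2 (w j x / Q j) ∂(m j)
      by_contra hneg
      rw [not_le] at hneg
      set K := Q j * (m j).real (α ⁻¹' {a}) / Real.log 2 with hK
      have hK0 : 0 ≤ K := by
        have := (hQ j).le
        have : 0 < Real.log 2 := Real.log_pos (by norm_num)
        positivity
      have hpos : 0 < -c / (2 * (K + 1)) := div_pos (by linarith) (by linarith)
      have h5 := hg _ hpos
      have h6 : (0 - Q j * (-c / (2 * (K + 1))) * (m j).real (α ⁻¹' {a})) / Real.log 2 =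
          - (K * (-c / (2 * (K + 1)))) := by rw [hK]; ring
      rw [h6] at h5
      have h7 : K * (-c / (2 * (K + 1))) ≤ -c / 2 := by
        rw [← mul_div_assoc, div_le_div_iff₀ (by linarith) (by norm_num)]
        nlinarith
      linarith)
    (fun j a θ hθ => by
      rw [hrI]
      exact gibbs_set (hw j) (h0 j) (h1 j) (Q j) (hQ j) (m j) (α ⁻¹' {a}) θ hθ)
  refine hfin.trans_eq (Finset.sum_congr rfl fun j _ => ?_)
  have hint := integrable_mul_logb (hw j) (h0 j) (h1 j) (Q j) (hQ j) (m j)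
  rw [← integral_iUnion_fintype (f := fun x => w j x * Real.logb 2 (w j x / Q j)) (μ := m j) hαm
    (fun i k hik => Disjoint.preimage _ (by simpa using hik)) (fun a => hint.integrableOn)]
  have : ⋃ a, α ⁻¹' {a} = univ := by ext; simp
  rw [this, Measure.restrict_univ]

theorem RDCode.J_eq {d : ℕ} {L : ℝ} (C : RDCode X d L) (ν : Measure X) [IsFiniteMeasure ν] :
    C.J ν = ENNReal.ofReal (∑ j, ∫ x, C.W x j * Real.logb 2 (C.W x j / C.q j) ∂ν) := by
  have hi : ∀ j, Integrable (fun x => C.W x j * Real.logb 2 (C.W x j / C.q j)) ν := fun j =>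
    integrable_mul_logb (C.hWm j) (fun x => C.hW0 x j) (fun x => C.W_le_one x j) _ (C.hq0 j) ν
  rw [← integral_finsetSum _ (fun j _ => hi j)]
  have : Integrable C.F ν := integrable_finsetSum _ (fun j _ => hi j)
  exact (ofReal_integral_eq_lintegral_ofReal this
    (Eventually.of_forall fun x => C.F_nonneg x)).symm

/-- achievability for mixtures of codes -/
theorem ach_mix {d : ℕ} {T : (Fin d → ℝ) → X → X} (hT : IsContAction d T) {L : ℝ} (hL : 0 < L)
    {n : ℕ} (hn : 0 < n) (C : Fin n → RDCode X d L) (μ : Measure X) [IsProbabilityMeasure μ]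
    (m : Fin n → Measure X) (hm : ∑ k, m k = μ) (ε : ℝ)
    (hε : ∑ k, (C k).D T (m k) < ENNReal.ofReal ε) :
    RL d T μ L ε ≤ ENNReal.ofReal (Real.logb 2 n) + ∑ k, (C k).J (m k) := by
  classical
  have hle : ∀ k, m k ≤ μ := fun k => by
    rw [← hm]
    intro A
    rw [Measure.finsetSum_apply]
    exact Finset.single_le_sum (f := fun j => m j A) (fun _ _ => bot_le) (Finset.mem_univ k)
  have hmf : ∀ j, IsFiniteMeasure (m j) := fun j => isFiniteMeasure_of_le μ (hle j)
  have hn' : (0 : ℝ) < n := by exact_mod_cast hn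
  have hln : 0 ≤ Real.logb 2 n := Real.logb_nonneg (by norm_num) (by exact_mod_cast hn)
  have hach := ach_flat hT hL (ι := Σ k : Fin n, (C k).ι) μ (fun j => m j.1) (fun j => hle j.1)
    (fun j x => (C j.1).W x j.2) (fun j => (C j.1).hWm j.2) (fun j x => (C j.1).hW0 x j.2)
    (fun j x => (C j.1).W_le_one x j.2) (by
      rw [Fintype.sum_sigma, ← hm]
      refine Finset.sum_congr rfl fun k _ => ?_
      ext A hA
      rw [Measure.finsetSum_apply]
      simp only [withDensity_apply _ hA]
      rw [← lintegral_finsetSum _ (fun j _ => ((C k).hWm j).ennreal_ofReal)]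
      have : ∀ x, ∑ j, ENNReal.ofReal ((C k).W x j) = 1 := fun x => by
        rw [← ENNReal.ofReal_sum_of_nonneg (fun j _ => (C k).hW0 x j), (C k).hW1]; simp
      simp [this])
    (fun j => (C j.1).q j.2 / n) (fun j => div_pos ((C j.1).hq0 j.2) hn')
    (by
      rw [Fintype.sum_sigma]
      simp_rw [← Finset.sum_div, (C _).hq1]
      rw [Finset.sum_const, Finset.card_univ, Fintype.card_fin, nsmul_eq_mul]
      field_simp; simp)
    (fun j => (C j.1).y j.2) ε (by
      rw [Fintype.sum_sigma]
      refine lt_of_eq_of_lt (Finset.sum_congr rfl fun k _ => ?_) hε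
      unfold RDCode.D RDCode.G
      have hmr : ∀ j, Measurable fun x => ENNReal.ofReal ((C k).W x j * rho d T L x ((C k).y j)) :=
        fun j => (((C k).hWm j).mul (continuous_rho hT L hL ((C k).y j)).measurable).ennreal_ofReal
      dsimp only
      rw [← lintegral_finsetSum _ (fun j _ => hmr j)]
      refine lintegral_congr fun x => ?_
      rw [ENNReal.ofReal_sum_of_nonneg]
      exact fun j _ => mul_nonneg ((C k).hW0 x j) (rho_nonneg L hL x _))
  refine hach.trans ?_
  have hnn : ∀ k, 0 ≤ ∑ j, ∫ x, (C k).W x j * Real.logb 2 ((C k).W x j / (C k).q j) ∂(m k) := by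
    intro k
    rw [← integral_finsetSum _ (fun j _ => integrable_mul_logb ((C k).hWm j) (fun x => (C k).hW0 x j)
      (fun x => (C k).W_le_one x j) _ ((C k).hq0 j) (m k))]
    exact integral_nonneg fun x => (C k).F_nonneg x
  simp_rw [RDCode.J_eq]
  rw [← ENNReal.ofReal_sum_of_nonneg (fun k _ => hnn k),
    ← ENNReal.ofReal_add hln (Finset.sum_nonneg fun k _ => hnn k)]
  refine ENNReal.ofReal_le_ofReal (le_of_eq ?_)
  rw [Fintype.sum_sigma]
  have hmk : ∑ k, (m k).real univ = 1 := by
    have : μ.real univ = 1 := by simp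
    rw [← this, ← hm]
    unfold Measure.real
    rw [Measure.finsetSum_apply, ENNReal.toReal_sum (fun j _ => measure_ne_top _ _)]
  have key : ∀ k, ∑ j, ∫ x, (C k).W x j * Real.logb 2 ((C k).W x j / ((C k).q j / n)) ∂(m k) =
      (∑ j, ∫ x, (C k).W x j * Real.logb 2 ((C k).W x j / (C k).q j) ∂(m k)) +
        (m k).real univ * Real.logb 2 n := by
    intro k
    have hWi : ∀ j, Integrable (fun x => (C k).W x j) (m k) := fun j =>
      Integrable.of_bound ((C k).hWm j).aestronglyMeasurable 1 (Eventually.of_forall fun x => by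
      rw [Real.norm_of_nonneg ((C k).hW0 x j)]; exact (C k).W_le_one x j)
    have h1 : ∀ j, ∫ x, (C k).W x j * Real.logb 2 ((C k).W x j / ((C k).q j / n)) ∂(m k) =
      ∫ x, (C k).W x j * Real.logb 2 ((C k).W x j / (C k).q j) ∂(m k) +
        (∫ x, (C k).W x j ∂(m k)) * Real.logb 2 n := by
      intro j
      rw [← integral_mul_const, ← integral_add (integrable_mul_logb ((C k).hWm j)
        (fun x => (C k).hW0 x j) (fun x => (C k).W_le_one x j) _ ((C k).hq0 j) (m k))
        ((hWi j).mul_const _)]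
      refine integral_congr_ae (Eventually.of_forall fun x => ?_)
      simp only
      by_cases hx : (C k).W x j = 0
      · simp [hx]
      · rw [← mul_add, ← Real.logb_mul (div_ne_zero hx ((C k).hq0 j).ne') hn'.ne']
        congr 2
        field_simp
    simp_rw [h1]
    rw [Finset.sum_add_distrib, ← Finset.sum_mul, ← integral_finsetSum _ (fun j _ => hWi j)]
    simp_rw [(C k).hW1]
    simp
  simp_rw [key]
  rw [Finset.sum_add_distrib, ← Finset.sum_mul, hmk]
  ring

theorem ach_one {d : ℕ} {T : (Fin d → ℝ) → X → X} (hT : IsContAction d T) {L : ℝ} (hL : 0 < L)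
    (C : RDCode X d L) (μ : Measure X) [IsProbabilityMeasure μ] (ε : ℝ)
    (hε : C.D T μ < ENNReal.ofReal ε) :
    RL d T μ L ε ≤ C.J μ := by
  simpa using ach_mix hT hL (n := 1) one_pos (fun _ => C) μ (fun _ => μ) (by simp) ε (by simpa using hε)

theorem select {n : ℕ} (U : Fin n → Set X) (hU : ∀ i, MeasurableSet (U i)) (hc : ∀ x, ∃ i, x ∈ U i) :
    ∃ π : X → Fin n, Measurable π ∧ ∀ x, x ∈ U (π x) := by
  classical
  have hp : ∀ x, ∃ k : ℕ, ∃ h : k < n, x ∈ U ⟨k, h⟩ := fun x => by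
    obtain ⟨i, hi⟩ := hc x
    exact ⟨i.1, i.2, hi⟩
  have hm : Measurable fun x => Nat.find (hp x) := by
    refine measurable_find hp fun k => ?_
    by_cases h : k < n
    · simpa [h] using hU ⟨k, h⟩
    · simp [h]
  refine ⟨fun x => ⟨Nat.find (hp x), (Nat.find_spec (hp x)).1⟩, ?_, fun x => (Nat.find_spec (hp x)).2⟩
  refine measurable_to_countable' fun i => ?_
  have : (fun x => (⟨Nat.find (hp x), (Nat.find_spec (hp x)).1⟩ : Fin n)) ⁻¹' {i} =
      (fun x => Nat.find (hp x)) ⁻¹' {i.1} := by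
    ext x
    simp [Fin.ext_iff]
  rw [this]
  exact hm (measurableSet_singleton _)

theorem quant {d : ℕ} {T : (Fin d → ℝ) → X → X} (hT : IsContAction d T) [Nonempty X] {L : ℝ}
    (hL : 0 < L) {δ : ℝ} (hδ : 0 < δ) :
    ∃ (n m : ℕ) (π : X → Fin n) (xh : Fin n → X) (β : L1Maps d L X → Fin m)
      (yh : Fin m → L1Maps d L X), Measurable π ∧ Measurable β ∧
      (∀ x y, |rho d T L x y - rho d T L (xh (π x)) y| ≤ δ) ∧
      (∀ i y, |rho d T L (xh i) (yh (β y)) - rho d T L (xh i) y| ≤ δ) := by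
  classical
  obtain ⟨γ, hγ, hγ'⟩ := unif_cont hT L δ hδ
  obtain ⟨t, -, htf, htc⟩ := (isCompact_univ (X := X)).finite_cover_balls hγ
  obtain ⟨n, xh, hxh⟩ : ∃ (n : ℕ) (xh : Fin n → X), range xh = t := by
    have := htf.to_subtype
    obtain ⟨n, ⟨e⟩⟩ := Finite.exists_equiv_fin t
    exact ⟨n, fun i => (e.symm i : X), by rw [range_comp' Subtype.val e.symm]; simp⟩
  obtain ⟨π, hπ, hπ'⟩ := select (fun i => Metric.ball (xh i) γ) (fun i => measurableSet_ball)
    (fun x => by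
      obtain ⟨z, hz, hxz⟩ := mem_iUnion₂.1 (htc (mem_univ x))
      rw [← hxh] at hz
      obtain ⟨i, rfl⟩ := hz
      exact ⟨i, hxz⟩)
  set K := ⌊Metric.diam (univ : Set X) / δ⌋₊ + 1 with hK
  have hlt : ∀ i (y : L1Maps d L X), ⌊rho d T L (xh i) y / δ⌋₊ < K := fun i y => by
    rw [hK, Nat.lt_succ_iff]
    exact Nat.floor_mono (div_le_div_of_nonneg_right (rho_le_diam hT L hL _ _) hδ.le)
  set v : L1Maps d L X → Fin n → Fin K := fun y i => ⟨⌊rho d T L (xh i) y / δ⌋₊, hlt i y⟩ with hv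
  have hvm : Measurable v := by
    refine measurable_pi_lambda _ fun i => measurable_to_countable' fun k => ?_
    have : (fun y => v y i) ⁻¹' {k} = (fun y => ⌊rho d T L (xh i) y / δ⌋₊) ⁻¹' {k.1} := by
      ext y
      simp [hv, Fin.ext_iff]
    rw [this]
    exact (Nat.measurable_floor.comp ((measurable_rho_right hT L (xh i)).div_const δ))
      (measurableSet_singleton _)
  set e := Fintype.equivFin (Fin n → Fin K) with he
  set β : L1Maps d L X → Fin (Fintype.card (Fin n → Fin K)) := fun y => e (v y) with hβ
  have hβm : Measurable β := (Measurable.of_discrete (f := e)).comp hvm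
  refine ⟨n, _, π, xh, β, fun k => if h : ∃ y, β y = k then h.choose
    else orbitPath hT L (Classical.arbitrary X), hπ, hβm, ?_, ?_⟩
  · intro x y
    have h1 := hπ' x
    rw [Metric.mem_ball] at h1
    have h2 := rho_le_add hT L hL x (xh (π x)) y δ (hγ' _ _ h1)
    have h3 := rho_le_add hT L hL (xh (π x)) x y δ (hγ' _ _ (by rwa [dist_comm]))
    rw [abs_le]
    constructor <;> linarith
  · intro i y
    have hex : ∃ y', β y' = β y := ⟨y, rfl⟩
    dsimp only
    rw [dif_pos hex]
    have h1 := hex.choose_spec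
    set y' := hex.choose
    have h2 : v y' = v y := e.injective h1
    have h3 : ⌊rho d T L (xh i) y' / δ⌋₊ = ⌊rho d T L (xh i) y / δ⌋₊ := by
      have := congrFun h2 i
      simpa [hv, Fin.ext_iff] using this
    have a1 := Nat.floor_le (div_nonneg (rho_nonneg (T := T) L hL (xh i) y') hδ.le)
    have a2 := Nat.floor_le (div_nonneg (rho_nonneg (T := T) L hL (xh i) y) hδ.le)
    have b1 := Nat.lt_floor_add_one (rho d T L (xh i) y' / δ)
    have b2 := Nat.lt_floor_add_one (rho d T L (xh i) y / δ)
    rw [h3] at a1 b1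
    rw [le_div_iff₀ hδ] at a1 a2
    rw [div_lt_iff₀ hδ] at b1 b2
    rw [abs_le]
    constructor <;> linarith

/-- finite quantisation data -/
structure Quant (X : Type*) [MetricSpace X] [MeasurableSpace X] (d : ℕ) (T : (Fin d → ℝ) → X → X)
    (L δ : ℝ) where
  n : ℕ
  m : ℕ
  π : X → Fin n
  xh : Fin n → X
  β : L1Maps d L X → Fin m
  yh : Fin m → L1Maps d L X
  hπ : Measurable π
  hβ : Measurable β
  h1 : ∀ x y, |rho d T L x y - rho d T L (xh (π x)) y| ≤ δ
  h2 : ∀ i y, |rho d T L (xh i) (yh (β y)) - rho d T L (xh i) y| ≤ δ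

theorem Quant.nonempty {d : ℕ} {T : (Fin d → ℝ) → X → X} (hT : IsContAction d T) [Nonempty X] {L : ℝ}
    (hL : 0 < L) {δ : ℝ} (hδ : 0 < δ) : Nonempty (Quant X d T L δ) := by
  obtain ⟨n, m, π, xh, β, yh, a, b, c, e⟩ := quant (X := X) hT hL hδ
  exact ⟨⟨n, m, π, xh, β, yh, a, b, c, e⟩⟩

/-- stochastic matrices with full-support reference vectors -/
abbrev SMat (n m : ℕ) := {p : (Fin n → Fin m → ℝ) × (Fin m → ℝ) //
  (∀ i j, 0 ≤ p.1 i j) ∧ (∀ i, ∑ j, p.1 i j = 1) ∧ (∀ j, 0 < p.2 j) ∧ ∑ j, p.2 j = 1}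

/-- code associated with a quantiser and a stochastic matrix -/
def Quant.toCode {d : ℕ} {T : (Fin d → ℝ) → X → X} {L δ : ℝ} (Q : Quant X d T L δ)
    (p : SMat Q.n Q.m) : RDCode X d L where
  ι := Fin Q.m
  fin := inferInstance
  W := fun x j => p.1.1 (Q.π x) j
  hWm := fun j => (Measurable.of_discrete (f := fun i => p.1.1 i j)).comp Q.hπ
  hW0 := fun x j => p.2.1 _ j
  hW1 := fun x => p.2.2.1 _
  q := p.1.2
  hq0 := p.2.2.2.1
  hq1 := p.2.2.2.2
  y := Q.yh

theorem integral_part {n : ℕ} {π : X → Fin n} (hπ : Measurable π) (g : Fin n → X → ℝ)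
    (ν : Measure X) (hi : ∀ i, Integrable (g i) ν) :
    ∫ x, g (π x) x ∂ν = ∑ i, ∫ x in π ⁻¹' {i}, g i x ∂ν := by
  have hm : ∀ i, MeasurableSet (π ⁻¹' {i}) := fun i => hπ (measurableSet_singleton i)
  have hu : ⋃ a, π ⁻¹' {a} = univ := by ext; simp
  rw [← setIntegral_univ, ← hu, integral_iUnion_fintype hm
    (fun i k hik => Disjoint.preimage _ (by simpa using hik))]
  · refine Finset.sum_congr rfl fun i _ => setIntegral_congr_fun (hm i) ?_
    intro x hx
    simp only [mem_preimage, mem_singleton_iff] at hx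
    simp [hx]
  · intro i
    refine (hi i).integrableOn.congr_fun ?_ (hm i)
    intro x hx
    simp only [mem_preimage, mem_singleton_iff] at hx
    simp [hx]

theorem Quant.toCode_J {d : ℕ} {T : (Fin d → ℝ) → X → X} {L δ : ℝ} (Q : Quant X d T L δ)
    (p : SMat Q.n Q.m) (ν : Measure X) [IsFiniteMeasure ν] :
    (Q.toCode p).J ν = ENNReal.ofReal (∑ i, ν.real (Q.π ⁻¹' {i}) *
      ∑ j, p.1.1 i j * Real.logb 2 (p.1.1 i j / p.1.2 j)) := by
  unfold RDCode.J
  have hF : ∀ x, (Q.toCode p).F x =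
    (fun i (_ : X) => ∑ j, p.1.1 i j * Real.logb 2 (p.1.1 i j / p.1.2 j)) (Q.π x) x := fun x => rfl
  rw [← ofReal_integral_eq_lintegral_ofReal]
  · congr 1
    simp_rw [hF]
    rw [integral_part Q.hπ (fun i (_ : X) => ∑ j, p.1.1 i j * Real.logb 2 (p.1.1 i j / p.1.2 j)) ν
      (fun i => integrable_const _)]
    simp
  · exact Integrable.comp_measurable (f := Q.π) (g := fun i =>
      ∑ j, p.1.1 i j * Real.logb 2 (p.1.1 i j / p.1.2 j)) (Integrable.of_finite) Q.hπ
  · exact Eventually.of_forall fun x => (Q.toCode p).F_nonneg x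

theorem integrable_rho {d : ℕ} {T : (Fin d → ℝ) → X → X} (hT : IsContAction d T) {L : ℝ} (hL : 0 < L)
    (ν : Measure X) [IsFiniteMeasure ν] (y : L1Maps d L X) :
    Integrable (fun x => rho d T L x y) ν := by
  refine Integrable.of_bound (continuous_rho hT L hL y).measurable.aestronglyMeasurable
    (Metric.diam (univ : Set X)) (Eventually.of_forall fun x => ?_)
  rw [Real.norm_of_nonneg (rho_nonneg L hL _ _)]
  exact rho_le_diam hT L hL _ _

theorem Quant.toCode_D {d : ℕ} {T : (Fin d → ℝ) → X → X} (hT : IsContAction d T) {L δ : ℝ}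
    (hL : 0 < L) (Q : Quant X d T L δ)
    (p : SMat Q.n Q.m) (ν : Measure X) [IsFiniteMeasure ν] :
    (Q.toCode p).D T ν = ENNReal.ofReal (∑ i, ∑ j, p.1.1 i j *
      ∫ x in Q.π ⁻¹' {i}, rho d T L x (Q.yh j) ∂ν) := by
  unfold RDCode.D
  have hG : ∀ x, (Q.toCode p).G T x =
    (fun i (x : X) => ∑ j, p.1.1 i j * rho d T L x (Q.yh j)) (Q.π x) x := fun x => rfl
  have hi : ∀ i, Integrable (fun x : X => ∑ j, p.1.1 i j * rho d T L x (Q.yh j)) ν := fun i =>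
    integrable_finsetSum _ fun j _ => (integrable_rho hT hL ν _).const_mul _
  rw [← ofReal_integral_eq_lintegral_ofReal]
  · congr 1
    simp_rw [hG]
    rw [integral_part Q.hπ (fun i (x : X) => ∑ j, p.1.1 i j * rho d T L x (Q.yh j)) ν hi]
    refine Finset.sum_congr rfl fun i _ => ?_
    rw [integral_finsetSum _ fun j _ => ((integrable_rho hT hL ν _).const_mul _).integrableOn]
    simp_rw [integral_const_mul]
  · refine Integrable.of_bound ((Q.toCode p).measurable_G hT hL).aestronglyMeasurable
      (Metric.diam (univ : Set X)) (Eventually.of_forall fun x => ?_)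
    rw [Real.norm_of_nonneg ((Q.toCode p).G_nonneg hL x)]
    unfold RDCode.G
    calc _ ≤ ∑ j, (Q.toCode p).W x j * Metric.diam (univ : Set X) :=
          Finset.sum_le_sum fun j _ => mul_le_mul_of_nonneg_left (rho_le_diam hT L hL _ _)
            ((Q.toCode p).hW0 x j)
      _ = _ := by rw [← Finset.sum_mul, (Q.toCode p).hW1, one_mul]
  · exact Eventually.of_forall fun x => (Q.toCode p).G_nonneg hL x

theorem cont_Jf {n m : ℕ} (a : Fin n → ℝ) :
    Continuous fun p : SMat n m => ∑ i, a i *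
      ∑ j, p.1.1 i j * Real.logb 2 (p.1.1 i j / p.1.2 j) := by
  refine continuous_finsetSum _ fun i _ => continuous_const.mul (continuous_finsetSum _ fun j _ => ?_)
  have h : ∀ p : SMat n m, p.1.1 i j * Real.logb 2 (p.1.1 i j / p.1.2 j) =
      (p.1.1 i j * Real.log (p.1.1 i j) - p.1.1 i j * Real.log (p.1.2 j)) / Real.log 2 := by
    intro p
    by_cases h0 : p.1.1 i j = 0
    · simp [h0]
    · unfold Real.logb
      rw [Real.log_div h0 (p.2.2.2.1 j).ne']
      ring
  simp_rw [h]
  have c1 : Continuous fun p : SMat n m => p.1.1 i j := by fun_prop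
  have c2 : Continuous fun p : SMat n m => p.1.2 j := by fun_prop
  have c3 : Continuous fun p : SMat n m => Real.log (p.1.2 j) := c2.log fun p => (p.2.2.2.1 j).ne'
  exact (((Real.continuous_mul_log).comp c1).sub (c1.mul c3)).div_const _

theorem cont_Df {n m : ℕ} (c : Fin n → Fin m → ℝ) :
    Continuous fun p : SMat n m => ∑ i, ∑ j, p.1.1 i j * c i j := by
  refine continuous_finsetSum _ fun i _ => continuous_finsetSum _ fun j _ => ?_
  have c1 : Continuous fun p : SMat n m => p.1.1 i j := by fun_prop
  exact c1.mul continuous_const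

theorem smat_exists {n m : ℕ} (hm : 0 < m) (r : Fin n → Fin m → ℝ) (h0 : ∀ i j, 0 ≤ r i j)
    (p : Fin n → ℝ) (hp : ∀ i, ∑ j, r i j = p i) (s : Fin m → ℝ) (hs : ∀ j, ∑ i, r i j = s j)
    (hp1 : ∑ i, p i = 1) (θ : ℝ) (hθ0 : 0 < θ) (hθ1 : θ < 1) :
    ∃ M : SMat n m, (∀ i j, p i * M.1.1 i j = r i j) ∧
      ∑ i, p i * ∑ j, M.1.1 i j * Real.logb 2 (M.1.1 i j / M.1.2 j) ≤
        (∑ i, ∑ j, r i j * Real.logb 2 (r i j / (p i * s j))) - Real.logb 2 (1 - θ) := by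
  have hm' : (0 : ℝ) < m := by exact_mod_cast hm
  have hs1 : ∑ j, s j = 1 := by
    simp_rw [← hs]
    rw [Finset.sum_comm]
    simp_rw [hp, hp1]
  have hs0 : ∀ j, 0 ≤ s j := fun j => by rw [← hs]; exact Finset.sum_nonneg fun i _ => h0 i j
  have hp0 : ∀ i, 0 ≤ p i := fun i => by rw [← hp]; exact Finset.sum_nonneg fun j _ => h0 i j
  have hrp : ∀ i j, r i j ≤ p i := fun i j => by
    rw [← hp]; exact Finset.single_le_sum (f := fun j => r i j) (fun j _ => h0 i j) (Finset.mem_univ j)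
  have hrs : ∀ i j, r i j ≤ s j := fun i j => by
    rw [← hs]; exact Finset.single_le_sum (f := fun i => r i j) (fun i _ => h0 i j) (Finset.mem_univ i)
  let W : Fin n → Fin m → ℝ := fun i j => if p i = 0 then 1 / m else r i j / p i
  let q : Fin m → ℝ := fun j => (1 - θ) * s j + θ / m
  have hq0 : ∀ j, 0 < q j := fun j => by
    have := mul_nonneg (sub_nonneg.2 hθ1.le) (hs0 j)
    have : 0 < θ / m := by positivity
    simp only [q]; linarith
  have hWr : ∀ i j, p i * W i j = r i j := by
    intro i j
    simp only [W]
    split_ifs with h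
    · have := hrp i j
      rw [h] at this
      have := le_antisymm this (h0 i j)
      simp [h, this]
    · field_simp
  refine ⟨⟨(W, q), ?_, ?_, hq0, ?_⟩, hWr, ?_⟩
  · intro i j
    simp only [W]
    split_ifs
    · positivity
    · exact div_nonneg (h0 i j) (hp0 i)
  · intro i
    simp only [W]
    split_ifs with h
    · simp [hm'.ne']
    · rw [← Finset.sum_div, hp, div_self h]
  · simp only [q]
    rw [Finset.sum_add_distrib, ← Finset.mul_sum, hs1]
    simp
    field_simp
    ring
  · have hsum : ∑ i, ∑ j, r i j = 1 := by simp_rw [hp, hp1]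
    have : (∑ i, ∑ j, r i j * Real.logb 2 (r i j / (p i * s j))) - Real.logb 2 (1 - θ) =
        ∑ i, ∑ j, (r i j * Real.logb 2 (r i j / (p i * s j)) - r i j * Real.logb 2 (1 - θ)) := by
      simp_rw [Finset.sum_sub_distrib, ← Finset.sum_mul]
      rw [hsum, one_mul]
    rw [this]
    refine Finset.sum_le_sum fun i _ => ?_
    rw [Finset.mul_sum]
    refine Finset.sum_le_sum fun j _ => ?_
    rw [← mul_assoc]
    change p i * W i j * Real.logb 2 (W i j / q j) ≤ _
    rw [hWr, ← mul_sub]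
    rcases (h0 i j).eq_or_lt with h | h
    · rw [← h]; simp
    · refine mul_le_mul_of_nonneg_left ?_ h.le
      have hpi : 0 < p i := h.trans_le (hrp i j)
      have hsj : 0 < s j := h.trans_le (hrs i j)
      have h1θ : 0 < 1 - θ := by linarith
      rw [← Real.logb_div (by positivity) h1θ.ne']
      have hW : W i j = r i j / p i := by simp [W, hpi.ne']
      rw [hW]
      refine Real.logb_le_logb_of_le (by norm_num) (by have := hq0 j; positivity) ?_
      rw [div_div, div_div]
      refine div_le_div_of_nonneg_left h.le (by positivity) ?_
      rw [mul_assoc]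
      refine mul_le_mul_of_nonneg_left ?_ hpi.le
      simp only [q]
      have : 0 < θ / m := by positivity
      nlinarith

theorem conv_aux {d : ℕ} {T : (Fin d → ℝ) → X → X} (hT : IsContAction d T) {L : ℝ} (hL : 0 < L)
    {Ω : Type} [MeasurableSpace Ω] (P : Measure Ω) [IsProbabilityMeasure P] (Xv : Ω → X)
    (Yv : Ω → L1Maps d L X) (hX : Measurable Xv) (hY : Measurable Yv) (e δ : ℝ)
    (hdist : distortion d T L P Xv Yv + 3 * δ < e) (r : ℝ≥0∞) (hr : mutualInfo P Xv Yv < r)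
    (Q : Quant X d T L δ) :
    ∃ M : SMat Q.n Q.m, (Q.toCode M).D T (Measure.map Xv P) < ENNReal.ofReal e ∧
      (Q.toCode M).J (Measure.map Xv P) < r := by
  have hν : IsProbabilityMeasure (Measure.map Xv P) := Measure.isProbabilityMeasure_map hX.aemeasurable
  have hΩ : Nonempty Ω := by
    by_contra h
    rw [not_nonempty_iff] at h
    have : P univ = 1 := measure_univ
    rw [univ_eq_empty_iff.2 h] at this
    simp at this
  obtain ⟨ω₀⟩ := hΩ
  have hm : 0 < Q.m := (Nat.zero_le _).trans_lt (Q.β (Yv ω₀)).2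
  have hA : Measurable fun ω => Q.π (Xv ω) := Q.hπ.comp hX
  have hB : Measurable fun ω => Q.β (Yv ω) := Q.hβ.comp hY
  set I := shannonEntropy P (fun ω => Q.π (Xv ω)) + shannonEntropy P (fun ω => Q.β (Yv ω))
      - shannonEntropy P (fun ω => (Q.π (Xv ω), Q.β (Yv ω))) with hI
  have hIr : ENNReal.ofReal I < r := by
    refine lt_of_le_of_lt ?_ hr
    unfold mutualInfo
    exact le_iSup_of_le Q.n (le_iSup_of_le Q.m (le_iSup_of_le Q.π (le_iSup_of_le Q.hπ
      (le_iSup_of_le Q.β (le_iSup_of_le Q.hβ le_rfl)))))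
  have hIe := ent_formula P _ hA _ hB
  rw [← hI] at hIe
  obtain ⟨θ, ⟨hθ0, hθ1⟩, hθ⟩ : ∃ θ : ℝ, (0 < θ ∧ θ < 1) ∧
      ENNReal.ofReal (I - Real.logb 2 (1 - θ)) < r := by
    have hc : ContinuousAt (fun θ : ℝ => ENNReal.ofReal (I - Real.logb 2 (1 - θ))) 0 := by
      refine ENNReal.continuous_ofReal.continuousAt.comp ?_
      unfold Real.logb
      refine ContinuousAt.sub continuousAt_const (ContinuousAt.div_const ?_ _)
      refine ContinuousAt.log (by fun_prop) (by norm_num)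
    have h1 : ∀ᶠ θ in 𝓝 (0 : ℝ), ENNReal.ofReal (I - Real.logb 2 (1 - θ)) < r :=
      hc.eventually_lt_const (by simpa using hIr)
    have h2 : ∀ᶠ θ in 𝓝[>] (0 : ℝ), θ ∈ Ioo (0 : ℝ) 1 := Ioo_mem_nhdsGT one_pos
    obtain ⟨θ, a, b⟩ := ((h1.filter_mono nhdsWithin_le_nhds).and h2).exists
    exact ⟨θ, b, a⟩
  set A : Ω → Fin Q.n := fun ω => Q.π (Xv ω) with hAd
  set B : Ω → Fin Q.m := fun ω => Q.β (Yv ω) with hBd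
  have key : ∀ (k : ℕ) (D : Ω → Fin k) (_ : Measurable D) (S : Set Ω) (_ : MeasurableSet S),
      ∑ b, P.real (S ∩ D ⁻¹' {b}) = P.real S := by
    intro k D hD S hS
    rw [← measureReal_biUnion_finset]
    · congr 1
      ext ω
      simp
    · intro i _ j _ hij
      exact Disjoint.inter_left' _ (Disjoint.inter_right' _ (Disjoint.preimage _ (by simpa using hij)))
    · intro b _
      exact hS.inter (hD (measurableSet_singleton b))
  obtain ⟨M, hM1, hM2⟩ := smat_exists hm (fun i j => P.real (A ⁻¹' {i} ∩ B ⁻¹' {j}))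
    (fun i j => measureReal_nonneg) (fun i => P.real (A ⁻¹' {i}))
    (fun i => key _ B hB _ (hA (measurableSet_singleton i))) (fun j => P.real (B ⁻¹' {j}))
    (fun j => by
      simp_rw [inter_comm _ (B ⁻¹' {j})]
      exact key _ A hA _ (hB (measurableSet_singleton j)))
    (by simpa using key _ A hA univ MeasurableSet.univ) θ hθ0 hθ1
  have hπν : ∀ i, (Measure.map Xv P).real (Q.π ⁻¹' {i}) = P.real (A ⁻¹' {i}) := fun i => by
    unfold Measure.real
    rw [Measure.map_apply hX (Q.hπ (measurableSet_singleton i))]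
    rfl
  refine ⟨M, ?_, ?_⟩
  · rw [Q.toCode_D hT hL]
    have hn : (fun ω => rho d T L (Xv ω) (Yv ω)) = fun ω => rho d T L (Xv ω) (Yv ω) := rfl
    have hrm : Measurable fun ω => rho d T L (Xv ω) (Yv ω) :=
      (measurable_rho hT L hL).comp (hX.prodMk hY)
    have hri : Integrable (fun ω => rho d T L (Xv ω) (Yv ω)) P := by
      refine Integrable.of_bound hrm.aestronglyMeasurable
        (Metric.diam (univ : Set X)) (Eventually.of_forall fun x => ?_)
      rw [Real.norm_of_nonneg (rho_nonneg L hL _ _)]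
      exact rho_le_diam hT L hL _ _
    have hd0 : distortion d T L P Xv Yv = ∫ ω, rho d T L (Xv ω) (Yv ω) ∂P := rfl
    have hδ0 : 0 ≤ δ := (abs_nonneg _).trans (Q.h1 (Xv ω₀) (Yv ω₀))
    have hdn : 0 ≤ distortion d T L P Xv Yv := by
      rw [hd0]; exact integral_nonneg fun ω => rho_nonneg L hL _ _
    refine (ENNReal.ofReal_lt_ofReal_iff (by linarith)).2 (lt_of_le_of_lt ?_ hdist)
    have s1 : ∀ i j, ∫ x in Q.π ⁻¹' {i}, rho d T L x (Q.yh j) ∂(Measure.map Xv P) ≤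
        P.real (A ⁻¹' {i}) * (rho d T L (Q.xh i) (Q.yh j) + δ) := by
      intro i j
      rw [← hπν]
      have := setIntegral_mono_on (μ := Measure.map Xv P) (s := Q.π ⁻¹' {i})
        (f := fun x => rho d T L x (Q.yh j)) (g := fun _ => rho d T L (Q.xh i) (Q.yh j) + δ)
        (integrable_rho hT hL _ _).integrableOn (integrable_const _).integrableOn
        (Q.hπ (measurableSet_singleton i)) (fun x hx => by
          simp only [mem_preimage, mem_singleton_iff] at hx
          have := (abs_le.1 (Q.h1 x (Q.yh j))).2
          rw [hx] at this
          linarith)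
      simpa using this
    have s2 : ∑ i, ∑ j, M.1.1 i j * ∫ x in Q.π ⁻¹' {i}, rho d T L x (Q.yh j) ∂(Measure.map Xv P) ≤
        ∑ i, ∑ j, P.real (A ⁻¹' {i} ∩ B ⁻¹' {j}) * (rho d T L (Q.xh i) (Q.yh j) + δ) := by
      refine Finset.sum_le_sum fun i _ => Finset.sum_le_sum fun j _ => ?_
      rw [← hM1, mul_comm (P.real _), mul_assoc]
      exact mul_le_mul_of_nonneg_left (s1 i j) (M.2.1 i j)
    refine s2.trans ?_
    have s3 : ∑ i, ∑ j, P.real (A ⁻¹' {i} ∩ B ⁻¹' {j}) * (rho d T L (Q.xh i) (Q.yh j) + δ) =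
        ∫ ω, (rho d T L (Q.xh (A ω)) (Q.yh (B ω)) + δ) ∂P := by
      have := integral_map (μ := P) (φ := fun ω => (A ω, B ω)) (hA.prodMk hB).aemeasurable
        (f := fun z : Fin Q.n × Fin Q.m => rho d T L (Q.xh z.1) (Q.yh z.2) + δ)
        (Measurable.of_discrete).aestronglyMeasurable
      rw [← this, integral_fintype (Integrable.of_finite), Fintype.sum_prod_type]
      refine Finset.sum_congr rfl fun i _ => Finset.sum_congr rfl fun j _ => ?_
      rw [smul_eq_mul]
      congr 1
      unfold Measure.real
      rw [Measure.map_apply (hA.prodMk hB) (measurableSet_singleton _)]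
      congr 2
      ext ω
      simp
    rw [s3, hd0]
    have s4 : ∫ ω, (rho d T L (Q.xh (A ω)) (Q.yh (B ω)) + δ) ∂P ≤
        ∫ ω, (rho d T L (Xv ω) (Yv ω) + 3 * δ) ∂P := by
      refine integral_mono_of_nonneg (Eventually.of_forall fun ω =>
        add_nonneg (rho_nonneg L hL _ _) hδ0) (hri.add (integrable_const _))
        (Eventually.of_forall fun ω => ?_)
      have a1 := (abs_le.1 (Q.h1 (Xv ω) (Yv ω))).1
      have a2 := (abs_le.1 (Q.h2 (Q.π (Xv ω)) (Yv ω))).2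
      simp only [hAd, hBd]
      linarith
    refine s4.trans_eq ?_
    rw [integral_add hri (integrable_const _)]
    simp
  · rw [Q.toCode_J]
    simp_rw [hπν]
    refine lt_of_le_of_lt (ENNReal.ofReal_le_ofReal (hM2.trans_eq ?_)) hθ
    rw [hIe]

theorem conv_countable {d : ℕ} {T : (Fin d → ℝ) → X → X} (hT : IsContAction d T) [Nonempty X]
    {L : ℝ} (hL : 0 < L) : ∃ S : Set (RDCode X d L), S.Countable ∧
      ∀ (ν : Measure X) [IsProbabilityMeasure ν] (e : ℝ) (r : ℝ≥0∞), RL d T ν L e < r →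
        ∃ C ∈ S, C.D T ν < ENNReal.ofReal e ∧ C.J ν < r := by
  have hδ : ∀ k : ℕ, (0 : ℝ) < 1 / (k + 1) := fun k => by positivity
  let Q : ∀ k : ℕ, Quant X d T L (1 / (k + 1)) := fun k => (Quant.nonempty hT hL (hδ k)).some
  have hD : ∀ k, ∃ s : Set (SMat (Q k).n (Q k).m), s.Countable ∧ Dense s := fun k =>
    TopologicalSpace.exists_countable_dense _
  choose s hs1 hs2 using hD
  refine ⟨⋃ k, (Q k).toCode '' (s k), countable_iUnion fun k => (hs1 k).image _, ?_⟩
  intro ν hν e r hr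
  unfold RL at hr
  simp only [iInf_lt_iff] at hr
  obtain ⟨Ω, mΩ, P, hP, Xv, Yv, hX, hY, hmap, hdist, hI⟩ := hr
  obtain ⟨k, hk⟩ := exists_nat_one_div_lt (show 0 < (e - distortion d T L P Xv Yv) / 3 by linarith)
  obtain ⟨M, hM1, hM2⟩ := conv_aux hT hL P Xv Yv hX hY e (1 / (k + 1)) (by linarith) r hI (Q k)
  rw [hmap] at hM1 hM2
  have hopen : IsOpen {M : SMat (Q k).n (Q k).m | ((Q k).toCode M).D T ν < ENNReal.ofReal e ∧
      ((Q k).toCode M).J ν < r} := by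
    simp_rw [(Q k).toCode_D hT hL, (Q k).toCode_J]
    exact (isOpen_lt (ENNReal.continuous_ofReal.comp (cont_Df _)) continuous_const).inter
      (isOpen_lt (ENNReal.continuous_ofReal.comp (cont_Jf _)) continuous_const)
  obtain ⟨M', h1, h2⟩ := (hs2 k).exists_mem_open hopen ⟨M, hM1, hM2⟩
  exact ⟨_, mem_iUnion.2 ⟨k, M', h1, rfl⟩, h2⟩

theorem rho_orbitPath_self {d : ℕ} {T : (Fin d → ℝ) → X → X} (hT : IsContAction d T) {L : ℝ}
    (hL : 0 < L) (x : X) : rho d T L x (orbitPath hT L x) = 0 := by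
  refine le_antisymm ?_ (rho_nonneg L hL _ _)
  refine rho_le hT L hL x _ 0 ?_
  filter_upwards [orbitPath_ae hT L x] with u hu
  rw [hu]
  simp

theorem bdd_code {d : ℕ} {T : (Fin d → ℝ) → X → X} (hT : IsContAction d T) [Nonempty X] {L : ℝ}
    (hL : 0 < L) {c : ℝ} (hc : 0 < c) : ∃ (C : RDCode X d L) (B : ℝ), ∀ (ν : Measure X)
      [IsProbabilityMeasure ν], C.D T ν < ENNReal.ofReal c ∧ C.J ν ≤ ENNReal.ofReal B := by
  classical
  obtain ⟨Q⟩ := Quant.nonempty (X := X) hT hL (half_pos hc)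
  have hn : 0 < Q.n := (Nat.zero_le _).trans_lt (Q.π (Classical.arbitrary X)).2
  have hn' : (0 : ℝ) < Q.n := by exact_mod_cast hn
  let C : RDCode X d L :=
    { ι := Fin Q.n
      fin := inferInstance
      W := fun x j => if Q.π x = j then 1 else 0
      hWm := fun j => (Measurable.of_discrete (f := fun i => if i = j then (1 : ℝ) else 0)).comp Q.hπ
      hW0 := fun x j => by split_ifs <;> norm_num
      hW1 := fun x => by simp
      q := fun _ => 1 / Q.n
      hq0 := fun _ => by positivity
      hq1 := by simp [hn'.ne']
      y := fun j => orbitPath hT L (Q.xh j) }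
  refine ⟨C, Real.logb 2 Q.n, fun ν hν => ⟨?_, ?_⟩⟩
  · have hG : ∀ x, C.G T x ≤ c / 2 := by
      intro x
      have : C.G T x = rho d T L x (orbitPath hT L (Q.xh (Q.π x))) := by
        change ∑ j, (if Q.π x = j then (1 : ℝ) else 0) * rho d T L x (orbitPath hT L (Q.xh j)) = _
        simp
      rw [this]
      have h1 := (abs_le.1 (Q.h1 x (orbitPath hT L (Q.xh (Q.π x))))).2
      rw [rho_orbitPath_self hT hL] at h1
      linarith
    calc C.D T ν ≤ ∫⁻ _, ENNReal.ofReal (c / 2) ∂ν :=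
          lintegral_mono fun x => ENNReal.ofReal_le_ofReal (hG x)
      _ = ENNReal.ofReal (c / 2) := by simp
      _ < _ := (ENNReal.ofReal_lt_ofReal_iff hc).2 (by linarith)
  · have hF : ∀ x, C.F x = Real.logb 2 Q.n := by
      intro x
      change ∑ j, (if Q.π x = j then (1 : ℝ) else 0) *
        Real.logb 2 ((if Q.π x = j then (1 : ℝ) else 0) / (1 / Q.n)) = _
      simp
    unfold RDCode.J
    simp [hF]

theorem RD_lt_nat {d : ℕ} {T : (Fin d → ℝ) → X → X} (hT : IsContAction d T) [Nonempty X]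
    (ν : Measure X) [IsProbabilityMeasure ν] (hν : MeasInvariant d T ν) (e : ℝ) (r : ℝ≥0∞)
    (h : RD d T ν e < r) : ∃ L : ℕ, 0 < L ∧ RL d T ν L e / ENNReal.ofReal ((L : ℝ) ^ d) < r := by
  unfold RD at h
  simp only [iInf_lt_iff] at h
  obtain ⟨L₀, hL₀, h⟩ := h
  have hp : ∀ L : ℝ, 0 < L → ENNReal.ofReal (L ^ d) ≠ 0 := fun L hL => by
    rw [Ne, ENNReal.ofReal_eq_zero, not_le]; positivity
  rw [ENNReal.div_lt_iff (Or.inl (hp L₀ hL₀)) (Or.inl ENNReal.ofReal_ne_top)] at h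
  obtain ⟨S, -, hS⟩ := conv_countable hT hL₀
  obtain ⟨C, -, hD, hJ⟩ := hS ν e _ h
  set t : ℕ → ℝ≥0∞ := fun L => ENNReal.ofReal (((⌈L₀⁻¹ * (L : ℝ)⌉₊ : ℝ) / L * L₀) ^ d) with ht
  have hlim : Tendsto t atTop (𝓝 1) := by
    have h1 := (tendsto_nat_ceil_mul_div_atTop (R := ℝ) (a := L₀⁻¹) (by positivity)).comp
      tendsto_natCast_atTop_atTop
    have h2 := ENNReal.tendsto_ofReal ((h1.mul_const L₀).pow d)
    rw [inv_mul_cancel₀ hL₀.ne', one_pow, ENNReal.ofReal_one] at h2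
    exact h2
  have e1 : ∀ᶠ L in atTop, t L * C.D T ν < ENNReal.ofReal e := by
    have := ENNReal.Tendsto.mul_const (b := C.D T ν) hlim (Or.inl one_ne_zero)
    rw [one_mul] at this
    exact this.eventually_lt_const hD
  have e2 : ∀ᶠ L in atTop, t L * (C.J ν / ENNReal.ofReal (L₀ ^ d)) < r := by
    have := ENNReal.Tendsto.mul_const (b := C.J ν / ENNReal.ofReal (L₀ ^ d)) hlim (Or.inl one_ne_zero)
    rw [one_mul] at this
    refine this.eventually_lt_const ?_
    rwa [ENNReal.div_lt_iff (Or.inl (hp L₀ hL₀)) (Or.inl ENNReal.ofReal_ne_top)]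
  obtain ⟨L, hL1, hL2, hL⟩ := (e1.and (e2.and (eventually_gt_atTop 0))).exists
  refine ⟨L, hL, ?_⟩
  have hLr : (0 : ℝ) < L := by exact_mod_cast hL
  set N := ⌈L₀⁻¹ * (L : ℝ)⌉₊ with hN
  have hN0 : 0 < N := Nat.ceil_pos.2 (by positivity)
  have : NeZero N := ⟨hN0.ne'⟩
  have hNL : (L : ℝ) ≤ N * L₀ := by
    have := Nat.le_ceil (L₀⁻¹ * (L : ℝ))
    rw [← hN] at this
    calc (L : ℝ) = L₀⁻¹ * L * L₀ := by field_simp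
      _ ≤ _ := mul_le_mul_of_nonneg_right this hL₀.le
  have hteq : t L * ENNReal.ofReal ((L : ℝ) ^ d) = (N : ℝ≥0∞) ^ d * ENNReal.ofReal (L₀ ^ d) := by
    change ENNReal.ofReal (((N : ℝ) / L * L₀) ^ d) * _ = _
    rw [← ENNReal.ofReal_natCast, ← ENNReal.ofReal_pow (by positivity),
      ← ENNReal.ofReal_mul (by positivity), ← ENNReal.ofReal_mul (by positivity), ← mul_pow, ← mul_pow]
    congr 2
    field_simp
  have hD' : (C.cat hT N L).D T ν < ENNReal.ofReal e := by
    refine lt_of_le_of_lt ?_ hL1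
    have h3 := RDCode.cat_D hT hL₀ C N L hLr hNL ν hν
    rw [← mul_assoc, ← hteq, mul_comm (t L), mul_assoc] at h3
    exact (ENNReal.mul_le_mul_iff_right (hp _ hLr) ENNReal.ofReal_ne_top).1 h3
  refine lt_of_le_of_lt ?_ hL2
  rw [ENNReal.div_le_iff (hp _ hLr) ENNReal.ofReal_ne_top]
  refine (ach_one hT hLr _ ν e hD').trans ?_
  rw [RDCode.cat_J hT C N L ν hν, mul_right_comm, hteq, mul_assoc,
    ENNReal.mul_div_cancel (hp _ hL₀) ENNReal.ofReal_ne_top]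

theorem fam_exists {d : ℕ} {T : (Fin d → ℝ) → X → X} (hT : IsContAction d T) [Nonempty X]
    {c : ℝ} (hc : 0 < c) : ∃ (l : ℕ → ℕ) (C : ∀ k, RDCode X d (l k)) (B : ℝ), (∀ k, 0 < l k) ∧
      (∀ (ν : Measure X) [IsProbabilityMeasure ν], (C 0).D T ν < ENNReal.ofReal c ∧
        (C 0).J ν / ENNReal.ofReal ((l 0 : ℝ) ^ d) ≤ ENNReal.ofReal B) ∧
      ∀ (ν : Measure X) [IsProbabilityMeasure ν] (_ : MeasInvariant d T ν) (e : ℝ) (r : ℝ≥0∞),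
        RD d T ν e < r → ∃ k, (C k).D T ν < ENNReal.ofReal e ∧
          (C k).J ν / ENNReal.ofReal ((l k : ℝ) ^ d) < r := by
  have h1 : ∀ L : ℕ+, ∃ S : Set (RDCode X d ((L : ℕ) : ℝ)), S.Countable ∧
      ∀ (ν : Measure X) [IsProbabilityMeasure ν] (e : ℝ) (r : ℝ≥0∞), RL d T ν ((L : ℕ) : ℝ) e < r →
        ∃ C ∈ S, C.D T ν < ENNReal.ofReal e ∧ C.J ν < r := fun L =>
    conv_countable hT (by exact_mod_cast L.2)
  choose S hS1 hS2 using h1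
  obtain ⟨C0, B, hC0⟩ := bdd_code (X := X) hT (L := (((1 : ℕ+) : ℕ) : ℝ)) (by norm_num) hc
  let F0 : Σ L : ℕ+, RDCode X d ((L : ℕ) : ℝ) := ⟨1, C0⟩
  let SS : Set (Σ L : ℕ+, RDCode X d ((L : ℕ) : ℝ)) := insert F0 (⋃ L, Sigma.mk L '' (S L))
  have hSS : SS.Countable := (countable_iUnion fun L => (hS1 L).image _).insert _
  obtain ⟨g, hg⟩ := hSS.exists_eq_range ⟨F0, mem_insert _ _⟩
  let fam : ℕ → Σ L : ℕ+, RDCode X d ((L : ℕ) : ℝ) := fun k => Nat.casesOn k F0 g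
  refine ⟨fun k => (fam k).1, fun k => (fam k).2, B, fun k => (fam k).1.2, ?_, ?_⟩
  · intro ν hν
    refine ⟨(hC0 ν).1, ?_⟩
    change C0.J ν / ENNReal.ofReal ((((1 : ℕ+) : ℕ) : ℝ) ^ d) ≤ _
    simpa using (hC0 ν).2
  · intro ν hν hinv e r hr
    obtain ⟨L, hL, hlt⟩ := RD_lt_nat hT ν hinv e r hr
    have hp : ENNReal.ofReal ((L : ℝ) ^ d) ≠ 0 := by
      rw [Ne, ENNReal.ofReal_eq_zero, not_le]; positivity
    rw [ENNReal.div_lt_iff (Or.inl hp) (Or.inl ENNReal.ofReal_ne_top)] at hlt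
    obtain ⟨C, hCS, hD, hJ⟩ := hS2 ⟨L, hL⟩ ν e _ hlt
    have hmem : (⟨⟨L, hL⟩, C⟩ : Σ L : ℕ+, RDCode X d ((L : ℕ) : ℝ)) ∈ SS :=
      mem_insert_of_mem _ (mem_iUnion.2 ⟨⟨L, hL⟩, C, hCS, rfl⟩)
    rw [hg] at hmem
    obtain ⟨k, hk⟩ := hmem
    refine ⟨k + 1, ?_⟩
    change (g k).2.D T ν < _ ∧ (g k).2.J ν / ENNReal.ofReal ((((g k).1 : ℕ) : ℝ) ^ d) < r
    rw [hk]
    refine ⟨hD, ?_⟩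
    exact (ENNReal.div_lt_iff (Or.inl hp) (Or.inl ENNReal.ofReal_ne_top)).2 hJ

theorem measurable_coeM {d : ℕ} {T : (Fin d → ℝ) → X → X} :
    Measurable fun ν : InvM X d T => (ν.1 : Measure X) :=
  measurable_subtype_coe.comp measurable_subtype_coe

theorem part_lintegral {A : Type*} [MeasurableSpace A] (lam : Measure A) {n : ℕ} (S : Fin n → Set A)
    (hS : ∀ k, MeasurableSet (S k)) (hd : Pairwise (Function.onFun Disjoint S)) (hu : ⋃ k, S k = univ)
    (g : A → ℝ≥0∞) : ∑ k, ∫⁻ a in S k, g a ∂lam = ∫⁻ a, g a ∂lam := by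
  rw [← setLIntegral_univ (μ := lam), ← hu, lintegral_iUnion hS hd, tsum_fintype]

theorem mixing {d : ℕ} (hd : 0 < d) {T : (Fin d → ℝ) → X → X} (hT : IsContAction d T)
    (lam : Measure (InvM X d T)) (μ : Measure X) [IsProbabilityMeasure μ]
    (hbar : ∀ A : Set X, MeasurableSet A → μ A = ∫⁻ ν, (ν.1 : Measure X) A ∂lam) (ε : ℝ)
    {n : ℕ} (hn : 0 < n) (S : Fin n → Set (InvM X d T))
    (hS : ∀ k, MeasurableSet (S k)) (hdj : Pairwise (Function.onFun Disjoint S)) (hu : ⋃ k, S k = univ)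
    (l : Fin n → ℕ) (hl : ∀ k, 0 < l k) (C : ∀ k, RDCode X d (l k))
    (hε : ∑ k, ∫⁻ ν in S k, (C k).D T (ν.1 : Measure X) ∂lam < ENNReal.ofReal ε) :
    RD d T μ ε ≤ ∑ k, ∫⁻ ν in S k, (C k).J (ν.1 : Measure X) / ENNReal.ofReal ((l k : ℝ) ^ d) ∂lam := by
  have hp : ∀ L : ℝ, 0 < L → ENNReal.ofReal (L ^ d) ≠ 0 := fun L hL => by
    rw [Ne, ENNReal.ofReal_eq_zero, not_le]; positivity
  set mm : Fin n → Measure X := fun k => (lam.restrict (S k)).bind fun ν => (ν.1 : Measure X) with hmm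
  have hsum : ∑ k, mm k = μ := by
    ext A hA
    rw [Measure.finsetSum_apply, hbar A hA, ← part_lintegral lam S hS hdj hu]
    refine Finset.sum_congr rfl fun k _ => ?_
    rw [hmm]
    exact Measure.bind_apply hA measurable_coeM.aemeasurable
  have hbindD : ∀ k (L : ℝ) (_ : 0 < L) (C' : RDCode X d L),
      C'.D T (mm k) = ∫⁻ ν in S k, C'.D T (ν.1 : Measure X) ∂lam := by
    intro k L hL C'
    exact Measure.lintegral_bind measurable_coeM.aemeasurable
      (C'.measurable_G hT hL).ennreal_ofReal.aemeasurable
  have hbindJ : ∀ k (L : ℝ) (C' : RDCode X d L),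
      C'.J (mm k) = ∫⁻ ν in S k, C'.J (ν.1 : Measure X) ∂lam := by
    intro k L C'
    exact Measure.lintegral_bind measurable_coeM.aemeasurable C'.measurable_F.ennreal_ofReal.aemeasurable
  set R := ∑ k, ∫⁻ ν in S k, (C k).J (ν.1 : Measure X) / ENNReal.ofReal ((l k : ℝ) ^ d) ∂lam with hR
  have key : ∀ M : ℕ, 0 < M → RD d T μ ε ≤ ENNReal.ofReal (Real.logb 2 n) / (M : ℝ≥0∞) + R := by
    intro M hM
    set Lc : ℕ := M * ∏ k, l k with hLc
    have hprod : 0 < ∏ k, l k := Finset.prod_pos fun k _ => hl k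
    have hLc0 : 0 < Lc := Nat.mul_pos hM hprod
    have hLr : (0 : ℝ) < Lc := by exact_mod_cast hLc0
    have hdvd : ∀ k, ∃ N, Lc = l k * N := fun k =>
      (Finset.dvd_prod_of_mem l (Finset.mem_univ k)).mul_left M
    choose N hN using hdvd
    have hN0 : ∀ k, NeZero (N k) := fun k => ⟨fun h => by
      have := hN k
      rw [h, mul_zero] at this
      omega⟩
    have hNr : ∀ k, (Lc : ℝ) = N k * l k := fun k => by
      rw [hN k]; push_cast; ring
    have hNe : ∀ k, ENNReal.ofReal ((Lc : ℝ) ^ d) = (N k : ℝ≥0∞) ^ d * ENNReal.ofReal ((l k : ℝ) ^ d) := by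
      intro k
      rw [hNr k, mul_pow, ENNReal.ofReal_mul (by positivity), ENNReal.ofReal_pow (by positivity),
        ENNReal.ofReal_natCast]
    let C' : Fin n → RDCode X d (Lc : ℝ) := fun k => (C k).cat hT (N k) Lc
    have hD' : ∀ k (ν : InvM X d T), (C' k).D T (ν.1 : Measure X) ≤ (C k).D T (ν.1 : Measure X) := by
      intro k ν
      have h3 := RDCode.cat_D hT (by exact_mod_cast hl k) (C k) (N k) Lc hLr (hNr k).le
        (ν.1 : Measure X) ν.2
      rw [← mul_assoc, ← hNe k] at h3
      exact (ENNReal.mul_le_mul_iff_right (hp _ hLr) ENNReal.ofReal_ne_top).1 h3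
    have hJ' : ∀ k (ν : InvM X d T), (C' k).J (ν.1 : Measure X) =
        (C k).J (ν.1 : Measure X) / ENNReal.ofReal ((l k : ℝ) ^ d) * ENNReal.ofReal ((Lc : ℝ) ^ d) := by
      intro k ν
      have hlk : (0 : ℝ) < l k := by exact_mod_cast hl k
      rw [RDCode.cat_J hT (C k) (N k) Lc (ν.1 : Measure X) ν.2, hNe k, mul_comm, mul_comm (_ ^ d),
        ← mul_assoc, ENNReal.div_mul_cancel (hp _ hlk) ENNReal.ofReal_ne_top]
    have hmix := ach_mix hT hLr hn C' μ mm hsum ε (by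
      refine lt_of_le_of_lt (Finset.sum_le_sum fun k _ => ?_) hε
      rw [hbindD k _ hLr]
      exact lintegral_mono fun ν => hD' k ν)
    have hJs : ∑ k, (C' k).J (mm k) = R * ENNReal.ofReal ((Lc : ℝ) ^ d) := by
      rw [hR, Finset.sum_mul]
      refine Finset.sum_congr rfl fun k _ => ?_
      rw [hbindJ, ← lintegral_mul_const' _ _ ENNReal.ofReal_ne_top]
      exact lintegral_congr fun ν => hJ' k ν
    have h1 : RD d T μ ε ≤ RL d T μ Lc ε / ENNReal.ofReal ((Lc : ℝ) ^ d) := iInf₂_le (Lc : ℝ) hLr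
    refine h1.trans ?_
    rw [ENNReal.div_le_iff (hp _ hLr) ENNReal.ofReal_ne_top]
    refine hmix.trans ?_
    rw [hJs, add_mul]
    gcongr
    rw [ENNReal.div_eq_inv_mul, mul_right_comm]
    refine le_mul_of_one_le_left' ?_
    have hML : (M : ℝ≥0∞) ≤ ENNReal.ofReal ((Lc : ℝ) ^ d) := by
      rw [← ENNReal.ofReal_natCast]
      refine ENNReal.ofReal_le_ofReal ?_
      have h2 : M ≤ Lc ^ d := (Nat.le_mul_of_pos_right M hprod).trans (Nat.le_self_pow hd.ne' _)
      exact_mod_cast h2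
    calc (1 : ℝ≥0∞) = (M : ℝ≥0∞)⁻¹ * M := by
          rw [ENNReal.inv_mul_cancel (by exact_mod_cast hM.ne') (ENNReal.natCast_ne_top M)]
      _ ≤ _ := by gcongr
  have h0 : Tendsto (fun M : ℕ => ENNReal.ofReal (Real.logb 2 n) / (M : ℝ≥0∞)) atTop (𝓝 0) := by
    have := ENNReal.Tendsto.const_mul (a := ENNReal.ofReal (Real.logb 2 n))
      ENNReal.tendsto_inv_nat_nhds_zero (Or.inr ENNReal.ofReal_ne_top)
    simpa [div_eq_mul_inv] using this
  have hlim := h0.add (tendsto_const_nhds (x := R))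
  rw [zero_add] at hlim
  exact ge_of_tendsto hlim (eventually_gt_atTop 0 |>.mono key)

end helpers

/-- Lemma 3.7: upper bound of the rate distortion function of a barycenter, for distortion
profiles bounded below by a positive constant. -/
theorem RD_barycenter_le_of_bddBelow
    {X : Type*} [MetricSpace X] [CompactSpace X] [MeasurableSpace X] [BorelSpace X]
    (d : ℕ) (hd : 0 < d) (T : (Fin d → ℝ) → X → X) (hT : IsContAction d T)
    (lam : Measure (InvM X d T)) [IsProbabilityMeasure lam]
    (μ : Measure X) [IsProbabilityMeasure μ] (hμinv : MeasInvariant d T μ)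
    (hbar : ∀ A : Set X, MeasurableSet A → μ A = ∫⁻ ν, (ν.1 : Measure X) A ∂lam)
    (ε : ℝ) (hε : 0 < ε)
    (f : InvM X d T → ℝ) (hf : Measurable f) (hfpos : ∀ ν, 0 < f ν)
    (hfint : (∫⁻ ν, ENNReal.ofReal (f ν) ∂lam) ≤ ENNReal.ofReal ε)
    (c : ℝ) (hc : 0 < c) (hfc : ∀ ν, c ≤ f ν) :
    RD d T μ ε ≤ ∫⁻ ν, RD d T (ν.1 : Measure X) (f ν) ∂lam := by
  classical
  have hXne : Nonempty X := μ.nonempty_of_neZero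
  obtain ⟨l, C, B, hl, hC0, hC⟩ := fam_exists (X := X) hT hc
  set DD : ℕ → InvM X d T → ℝ≥0∞ := fun k ν => (C k).D T (ν.1 : Measure X) with hDD
  set JJ : ℕ → InvM X d T → ℝ≥0∞ := fun k ν =>
    (C k).J (ν.1 : Measure X) / ENNReal.ofReal ((l k : ℝ) ^ d) with hJJ
  have hDm : ∀ k, Measurable (DD k) := fun k =>
    (Measure.measurable_lintegral ((C k).measurable_G hT
      (by exact_mod_cast hl k)).ennreal_ofReal).comp measurable_coeM
  have hJm : ∀ k, Measurable (JJ k) := fun k =>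
    ((Measure.measurable_lintegral (C k).measurable_F.ennreal_ofReal).comp measurable_coeM).div_const _
  set φ : ℕ → InvM X d T → ℝ≥0∞ := fun k ν =>
    if DD k ν < ENNReal.ofReal (f ν) then JJ k ν else ⊤ with hφ
  have hφm : ∀ k, Measurable (φ k) := fun k =>
    Measurable.ite (measurableSet_lt (hDm k) hf.ennreal_ofReal) (hJm k) measurable_const
  set h : InvM X d T → ℝ≥0∞ := fun ν => ⨅ k, φ k ν with hh
  have hhm : Measurable h := Measurable.iInf hφm
  have hD0 : ∀ ν : InvM X d T, DD 0 ν < ENNReal.ofReal (f ν) := fun ν =>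
    (hC0 (ν.1 : Measure X)).1.trans_le (ENNReal.ofReal_le_ofReal (hfc ν))
  have hJ0 : ∀ ν : InvM X d T, JJ 0 ν ≤ ENNReal.ofReal B := fun ν => (hC0 (ν.1 : Measure X)).2
  have hφ0 : ∀ ν, φ 0 ν ≤ ENNReal.ofReal B := fun ν => by
    simp only [hφ, if_pos (hD0 ν)]
    exact hJ0 ν
  have hhB : ∀ ν, h ν ≤ ENNReal.ofReal B := fun ν => (iInf_le _ 0).trans (hφ0 ν)
  have hhR : ∀ ν, h ν ≤ RD d T (ν.1 : Measure X) (f ν) := by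
    intro ν
    refine le_of_forall_gt_imp_ge_of_dense fun r hr => ?_
    obtain ⟨k, h1, h2⟩ := hC (ν.1 : Measure X) ν.2 (f ν) r hr
    refine (iInf_le _ k).trans ?_
    simp only [hφ]
    rw [if_pos h1]
    exact h2.le
  refine le_trans ?_ (lintegral_mono hhR)
  refine ENNReal.le_of_forall_pos_le_add fun η hη _ => ?_
  have hex : ∀ ν, ∃ k, φ k ν < h ν + η := by
    intro ν
    have : h ν < h ν + η := ENNReal.lt_add_right ((hhB ν).trans_lt ENNReal.ofReal_lt_top).ne
      (by exact_mod_cast hη.ne')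
    exact iInf_lt_iff.1 this
  have him : Measurable fun ν => Nat.find (hex ν) :=
    measurable_find hex fun k => measurableSet_lt (hφm k) (hhm.add_const _)
  set idx : InvM X d T → ℕ := fun ν => Nat.find (hex ν) with hidx
  have hidx' : ∀ ν, φ (idx ν) ν < h ν + η := fun ν => Nat.find_spec (hex ν)
  have main : ∀ n : ℕ, 0 < n → RD d T μ ε ≤
      (∫⁻ ν, h ν ∂lam) + η + ENNReal.ofReal B * lam {ν | n ≤ idx ν} := by
    intro n hn
    set κ : InvM X d T → Fin n := fun ν => if hν : idx ν < n then ⟨idx ν, hν⟩ else ⟨0, hn⟩ with hκ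
    have hκm : Measurable κ := by
      have : κ = (fun k : ℕ => if hν : k < n then (⟨k, hν⟩ : Fin n) else ⟨0, hn⟩) ∘ idx := rfl
      rw [this]
      exact (Measurable.of_discrete).comp him
    have hκD : ∀ ν, DD (κ ν) ν < ENNReal.ofReal (f ν) := by
      intro ν
      by_cases hν : idx ν < n
      · simp only [hκ, dif_pos hν]
        by_contra hcon
        have := hidx' ν
        simp only [hφ, if_neg hcon] at this
        exact not_top_lt this
      · simp only [hκ, dif_neg hν]
        exact hD0 ν
    have hκJ : ∀ ν, JJ (κ ν) ν ≤ h ν + η + {ν | n ≤ idx ν}.indicator (fun _ => ENNReal.ofReal B) ν := by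
      intro ν
      by_cases hν : idx ν < n
      · refine le_trans ?_ le_self_add
        have h1 := hκD ν
        have h2 := hidx' ν
        simp only [hκ, dif_pos hν] at h1 ⊢
        simp only [hφ, if_pos h1] at h2
        exact h2.le
      · have : ν ∈ {ν | n ≤ idx ν} := not_lt.1 hν
        rw [indicator_of_mem this]
        simp only [hκ, dif_neg hν]
        exact (hJ0 ν).trans le_add_self
    have hSm : ∀ k : Fin n, MeasurableSet (κ ⁻¹' {k}) := fun k => hκm (measurableSet_singleton k)
    have hSd : Pairwise (Function.onFun Disjoint fun k : Fin n => κ ⁻¹' {k}) :=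
      fun i k hik => Disjoint.preimage _ (by simpa using hik)
    have hSu : ⋃ k : Fin n, κ ⁻¹' {k} = univ := by ext; simp
    have hcongr : ∀ g : ℕ → InvM X d T → ℝ≥0∞, ∑ k : Fin n, ∫⁻ ν in κ ⁻¹' {k}, g k ν ∂lam =
        ∫⁻ ν, g (κ ν) ν ∂lam := by
      intro g
      rw [← part_lintegral lam _ hSm hSd hSu]
      refine Finset.sum_congr rfl fun k _ => setLIntegral_congr_fun (hSm k) fun ν hν => ?_
      simp only [mem_preimage, mem_singleton_iff] at hν
      rw [hν]
    have hmix := mixing hd hT lam μ hbar ε hn (fun k => κ ⁻¹' {k}) hSm hSd hSu (fun k => l k)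
      (fun k => hl k) (fun k => C k) (by
        have h1 := hcongr DD
        simp only [hDD] at h1
        rw [h1]
        have hle : ∫⁻ ν, DD (κ ν) ν ∂lam ≤ ∫⁻ ν, ENNReal.ofReal (f ν) ∂lam :=
          lintegral_mono fun ν => (hκD ν).le
        refine lt_of_lt_of_le (lintegral_strict_mono (IsProbabilityMeasure.ne_zero lam)
          hf.ennreal_ofReal.aemeasurable ?_ (Eventually.of_forall hκD)) hfint
        exact ((hle.trans hfint).trans_lt ENNReal.ofReal_lt_top).ne)
    refine hmix.trans ?_
    have h2 := hcongr JJ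
    simp only [hJJ] at h2
    rw [h2]
    refine (lintegral_mono hκJ).trans ?_
    have hIm : MeasurableSet {ν | n ≤ idx ν} := him measurableSet_Ici
    rw [lintegral_add_right _ (measurable_const.indicator hIm), lintegral_add_right _ measurable_const,
      lintegral_indicator_const hIm]
    simp
  have hlim : Tendsto (fun n => lam {ν | n ≤ idx ν}) atTop (𝓝 0) := by
    have := tendsto_measure_iInter_atTop (μ := lam) (s := fun n : ℕ => {ν | n ≤ idx ν})
      (fun n => (him measurableSet_Ici).nullMeasurableSet)
      (fun a b hab ν (hν : b ≤ idx ν) => hab.trans hν) ⟨0, measure_ne_top _ _⟩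
    have he : ⋂ n : ℕ, {ν | n ≤ idx ν} = ∅ := by
      ext ν
      simp only [mem_iInter, mem_ofPred_eq, mem_empty_iff_false, iff_false, not_forall, not_le]
      exact ⟨idx ν + 1, Nat.lt_succ_self _⟩
    rw [he, measure_empty] at this
    exact this
  have hlim2 := (tendsto_const_nhds (x := (∫⁻ ν, h ν ∂lam) + η)).add
    (ENNReal.Tendsto.const_mul (a := ENNReal.ofReal B) hlim (Or.inr ENNReal.ofReal_ne_top))
  rw [mul_zero, add_zero] at hlim2
  exact ge_of_tendsto hlim2 ((eventually_gt_atTop 0).mono main)
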